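/- arXiv:1304.1429 — 4 statements merged into one kernel-verified Lean document; each statement's English description precedes it below -/
import Mathlib

section
/- Let α be an infinite set. Let K be a class of QPEA_α's that is a variety (closed under homomorphic images, subalgebras and products) and satisfies RQPEA_α ⊆ K ⊆ QPEA_α. Then K does not have the amalgamation property with respect to QPEA_α: there exist A₀, A₁, A₂ ∈ K and injective homomorphisms i₁ : A₀ → A₁ and i₂ : A₀ → A₂ such that there is no B ∈ QPEA_α together with injective homomorphisms m₁ : A₁ → B and m₂ : A₂ → B satisfying m₁ ∘ i₁ = m₂ ∘ i₂. In particular, the variety RQPEA_α of representable quasi-polyadic equality algebras of dimension α, and the variety QPEA_α itself, fail to have the amalgamation property. -/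
universe u

open Function Set

/-- A finite subset of the dimension (the index of a quasi-polyadic cylindrification). -/
def FinSet {α : Type u} (Γ : Set α) : Prop := Γ.Finite

/-- A transformation moving only finitely many points. -/
def FinSupp {α : Type u} (τ : α → α) : Prop := {i | τ i ≠ i}.Finite

/-- `[i|j]`, sending `i` to `j` and fixing every other point. -/
noncomputable def repl {α : Type u} (i j : α) : α → α :=
  haveI := Classical.decEq α
  fun a => if a = i then j else a

/-- The similarity type of quasi-polyadic equality algebras of dimension `α`: a Boolean
algebra with cylindrifications `c_{(Γ)}` (`Γ` finite), substitutions `s_τ` (`τ` of finite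
support) and diagonal constants `d_{ij}`. (The operations `c` and `s` are total; the
axioms below constrain them on finite indices.) -/
structure QPEA (α : Type u) : Type (u + 1) where
  carrier : Type u
  [ba : BooleanAlgebra carrier]
  c : Set α → carrier → carrier
  s : (α → α) → carrier → carrier
  d : α → α → carrier

attribute [instance] QPEA.ba

/-- The axioms of `QPEA_α`. -/
structure IsQPEA {α : Type u} (A : QPEA α) : Prop where
  c_bot : ∀ Γ, FinSet Γ → A.c Γ ⊥ = ⊥
  le_c : ∀ Γ x, FinSet Γ → x ≤ A.c Γ x
  c_inf_c : ∀ Γ x y, FinSet Γ → A.c Γ (x ⊓ A.c Γ y) = A.c Γ x ⊓ A.c Γ y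
  c_c : ∀ Γ Δ x, FinSet Γ → FinSet Δ → A.c Γ (A.c Δ x) = A.c (Γ ∪ Δ) x
  s_sup : ∀ τ x y, FinSupp τ → A.s τ (x ⊔ y) = A.s τ x ⊔ A.s τ y
  s_inf : ∀ τ x y, FinSupp τ → A.s τ (x ⊓ y) = A.s τ x ⊓ A.s τ y
  s_compl : ∀ τ x, FinSupp τ → A.s τ xᶜ = (A.s τ x)ᶜ
  s_bot : ∀ τ, FinSupp τ → A.s τ ⊥ = ⊥
  s_top : ∀ τ, FinSupp τ → A.s τ ⊤ = ⊤
  s_id : ∀ x, A.s id x = x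
  s_comp : ∀ σ τ x, FinSupp σ → FinSupp τ → A.s (σ ∘ τ) x = A.s σ (A.s τ x)
  s_c_congr : ∀ σ τ Γ x, FinSupp σ → FinSupp τ → FinSet Γ →
    (∀ i ∉ Γ, σ i = τ i) → A.s σ (A.c Γ x) = A.s τ (A.c Γ x)
  c_s : ∀ τ Γ Δ x, FinSupp τ → FinSet Γ → τ ⁻¹' Γ = Δ → Set.InjOn τ Δ →
    A.c Γ (A.s τ x) = A.s τ (A.c Δ x)
  d_refl : ∀ i, A.d i i = ⊤
  c_d_of_not_mem : ∀ Γ i j, FinSet Γ → i ∉ Γ → j ∉ Γ → A.c Γ (A.d i j) = A.d i j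
  c_d_of_mem : ∀ Γ i j, FinSet Γ → i ≠ j → (i ∈ Γ ∨ j ∈ Γ) → A.c Γ (A.d i j) = ⊤
  s_d : ∀ τ i j, FinSupp τ → A.s τ (A.d i j) = A.d (τ i) (τ j)
  inf_diag_le : ∀ i j x, x ⊓ A.d i j ≤ A.s (repl i j) x

/-- Homomorphisms of `QPEA`s. -/
structure IsQPEAHom {α : Type u} (A B : QPEA α) (f : A.carrier → B.carrier) : Prop where
  map_sup : ∀ x y, f (x ⊔ y) = f x ⊔ f y
  map_inf : ∀ x y, f (x ⊓ y) = f x ⊓ f y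
  map_compl : ∀ x, f xᶜ = (f x)ᶜ
  map_bot : f ⊥ = ⊥
  map_top : f ⊤ = ⊤
  map_c : ∀ Γ x, FinSet Γ → f (A.c Γ x) = B.c Γ (f x)
  map_s : ∀ τ x, FinSupp τ → f (A.s τ x) = B.s τ (f x)
  map_d : ∀ i j, f (A.d i j) = B.d i j

/-- The full quasi-polyadic set algebra on `ᵅU`. -/
def setQPEA (α : Type u) (U : Type u) : QPEA α where
  carrier := Set (α → U)
  c := fun Γ X => {s | ∃ t ∈ X, ∀ j ∉ Γ, t j = s j}
  s := fun τ X => {s | s ∘ τ ∈ X}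
  d := fun i j => {s | s i = s j}

/-- The product of a family of `QPEA`s. -/
def prodQPEA {α : Type u} {ι : Type u} (A : ι → QPEA α) : QPEA α where
  carrier := ∀ i, (A i).carrier
  c := fun Γ x i => (A i).c Γ (x i)
  s := fun τ x i => (A i).s τ (x i)
  d := fun i j k => (A k).d i j

/-- Representable quasi-polyadic equality algebras: algebras embeddable into a product of
full quasi-polyadic set algebras. -/
def IsRepresentableQPEA {α : Type u} (A : QPEA α) : Prop :=
  ∃ (ι : Type u) (U : ι → Type u)
    (f : A.carrier → (prodQPEA (fun i => setQPEA α (U i))).carrier),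
      IsQPEAHom A (prodQPEA (fun i => setQPEA α (U i))) f ∧ Function.Injective f

namespace QPAux

theorem finSupp_id {α : Type u} : FinSupp (id : α → α) := by
  simp [FinSupp]

theorem finSupp_comp {α : Type u} {σ τ : α → α} (hσ : FinSupp σ) (hτ : FinSupp τ) :
    FinSupp (σ ∘ τ) := by
  refine (hσ.union hτ).subset ?_
  intro i hi
  by_contra h
  simp only [Set.mem_union, Set.mem_ofPred_eq, not_or, not_not] at h
  apply hi
  simp [h.1, h.2]

theorem finSupp_repl {α : Type u} (i j : α) : FinSupp (repl i j) := by
  refine (Set.finite_singleton i).subset ?_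
  intro a ha
  by_contra h
  apply ha
  simp only [Set.mem_singleton_iff] at h
  simp [repl, h]

theorem repl_self {α : Type u} (i j : α) : repl i j i = j := by simp [repl]

theorem repl_ne {α : Type u} {i j a : α} (h : a ≠ i) : repl i j a = a := by simp [repl, h]

theorem finSupp_swap {α : Type u} [DecidableEq α] (i j : α) :
    FinSupp (Equiv.swap i j : α → α) := by
  refine (Set.toFinite {i, j}).subset ?_
  intro a ha
  by_contra h
  simp only [Set.mem_insert_iff, Set.mem_singleton_iff, not_or] at h
  exact ha (Equiv.swap_apply_of_ne_of_ne h.1 h.2)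

/-- An injective map of finite support is surjective. -/
theorem FinSupp.surj {α : Type u} {τ : α → α} (hτ : FinSupp τ) (hi : Function.Injective τ) :
    Function.Surjective τ := by
  have hm : Set.MapsTo τ {i | τ i ≠ i} {i | τ i ≠ i} := by
    intro i hi' h
    exact hi' (hi h)
  have hfin : Finite {i | τ i ≠ i} := hτ
  have hs := Finite.surjective_of_injective (f := hm.restrict) (hm.restrict_inj.2 hi.injOn)
  intro b
  by_cases hb : τ b = b
  · exact ⟨b, hb⟩
  · obtain ⟨a, ha⟩ := hs ⟨b, hb⟩
    exact ⟨a.1, congrArg Subtype.val ha⟩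

/-! ### The algebraic inequality -/

section Alg

variable {α : Type u} {B : QPEA α}

theorem c_mono (hB : IsQPEA B) {Γ : Set α} (hΓ : FinSet Γ) {x y : B.carrier} (h : x ≤ y) :
    B.c Γ x ≤ B.c Γ y := by
  have h1 : x ⊓ B.c Γ y = x := inf_eq_left.2 (h.trans (hB.le_c Γ y hΓ))
  have h2 := hB.c_inf_c Γ x y hΓ
  rw [h1] at h2
  rw [h2]
  exact inf_le_right

theorem c_idem (hB : IsQPEA B) {Γ : Set α} (hΓ : FinSet Γ) (x : B.carrier) :
    B.c Γ (B.c Γ x) = B.c Γ x := by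
  rw [hB.c_c Γ Γ x hΓ hΓ, Set.union_self]

theorem c_compl (hB : IsQPEA B) {Γ : Set α} (hΓ : FinSet Γ) {x : B.carrier}
    (h : B.c Γ x = x) : B.c Γ xᶜ = xᶜ := by
  apply le_antisymm _ (hB.le_c Γ _ hΓ)
  have h2 := hB.c_inf_c Γ xᶜ x hΓ
  rw [h, compl_inf_self, hB.c_bot Γ hΓ] at h2
  rw [le_compl_iff_disjoint_right, disjoint_iff]
  exact h2.symm

theorem c_inf (hB : IsQPEA B) {Γ : Set α} (hΓ : FinSet Γ) (x : B.carrier) {y : B.carrier}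
    (h : B.c Γ y = y) : B.c Γ (x ⊓ y) = B.c Γ x ⊓ y := by
  have h2 := hB.c_inf_c Γ x y hΓ
  rwa [h] at h2

/-- The key computation: a `c_b`-closed partial function in coordinate `a` cannot be split by a
`c_b`-closed element. -/
theorem key (hB : IsQPEA B) {a b : α} (hab : a ≠ b) {Y Z : B.carrier}
    (hY : B.c {b} Y = Y) (hZ : B.c {b} Z = Z)
    (hd : Z ⊓ B.s (repl a b) Z ≤ B.d a b) :
    B.c {a} (Z ⊓ Y) ⊓ B.c {a} (Z ⊓ Yᶜ) = ⊥ := by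
  classical
  have fa : FinSet ({a} : Set α) := Set.finite_singleton a
  have fb : FinSet ({b} : Set α) := Set.finite_singleton b
  have fab : FinSet ({a} ∪ {b} : Set α) := fa.union fb
  have fs := finSupp_swap a b
  have fr := finSupp_repl a b
  set P := Z ⊓ Y with hP
  set Q := Z ⊓ Yᶜ with hQ
  have cP : B.c {b} P = P := by rw [hP, c_inf hB fb _ hY, hZ]
  have cQ : B.c {b} Q = Q := by rw [hQ, c_inf hB fb _ (c_compl hB fb hY), hZ]
  have e1 : B.s (repl a b) Q = B.s (Equiv.swap a b) Q := by
    have := hB.s_c_congr (repl a b) (Equiv.swap a b) {b} Q fr fs fb (by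
      intro i hi
      by_cases hia : i = a
      · subst hia; simp [repl_self]
      · rw [repl_ne hia, Equiv.swap_apply_of_ne_of_ne hia hi])
    rwa [cQ] at this
  have pre1 : ((Equiv.swap a b : α → α)) ⁻¹' {b} = {a} := by
    ext i; simp [Equiv.swap_apply_eq_iff]
  have pre2 : ((Equiv.swap a b : α → α)) ⁻¹' {a} = {b} := by
    ext i; simp [Equiv.swap_apply_eq_iff]
  have e2 : B.c {a} (B.s (Equiv.swap a b) Q) = B.s (Equiv.swap a b) Q := by
    rw [hB.c_s _ {a} {b} Q fs fa pre2 (Equiv.injective _).injOn, cQ]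
  have cab : B.c {a} Q = B.c ({a} ∪ {b}) Q := by
    rw [← hB.c_c _ _ _ fa fb, cQ]
  have e3 : B.c {b} (B.s (Equiv.swap a b) Q) = B.c {a} Q := by
    rw [hB.c_s _ {b} {a} Q fs fb pre1 (Equiv.injective _).injOn, cab,
      hB.s_c_congr (Equiv.swap a b) id _ Q fs finSupp_id fab, hB.s_id]
    intro i hi
    simp only [Set.mem_union, Set.mem_singleton_iff, not_or] at hi
    exact Equiv.swap_apply_of_ne_of_ne hi.1 hi.2
  have cbP : B.c {b} (B.c {a} P) = B.c {a} P := by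
    rw [hB.c_c _ _ _ fb fa, Set.union_comm, ← hB.c_c _ _ _ fa fb, cP]
  have hle : P ⊓ B.s (repl a b) Q = ⊥ := by
    rw [eq_bot_iff]
    have i1 : P ⊓ B.s (repl a b) Q ≤ B.d a b := by
      refine le_trans (inf_le_inf inf_le_left ?_) hd
      rw [hQ, hB.s_inf _ _ _ fr]
      exact inf_le_left
    have i2 : P ⊓ B.s (repl a b) Q ≤ B.s (repl a b) Y :=
      le_trans (le_inf (inf_le_left.trans inf_le_right) i1) (hB.inf_diag_le a b Y)
    have i3 : P ⊓ B.s (repl a b) Q ≤ (B.s (repl a b) Y)ᶜ := by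
      refine inf_le_right.trans ?_
      rw [hQ, hB.s_inf _ _ _ fr, hB.s_compl _ _ fr]
      exact inf_le_right
    exact (le_inf i2 i3).trans (by rw [inf_compl_self])
  rw [e1] at hle
  rw [← e3, inf_comm, ← c_inf hB fb _ cbP, inf_comm, ← c_inf hB fa _ e2, hle,
    hB.c_bot _ fa, hB.c_bot _ fb]

theorem no_amalg (hB : IsQPEA B) {a b : α} (hab : a ≠ b) {X Y Z : B.carrier}
    (hY : B.c {b} Y = Y) (hZ : B.c {b} Z = Z)
    (hd : Z ⊓ B.s (repl a b) Z ≤ B.d a b)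
    (h1 : B.c {a} X ≤ B.c {a} (X ⊓ Y)) (h2 : B.c {a} X ≤ B.c {a} (X ⊓ Yᶜ)) :
    B.c {a} X ⊓ (B.c {a} (X ⊓ Zᶜ))ᶜ = ⊥ := by
  have fa : FinSet ({a} : Set α) := Set.finite_singleton a
  set F := (B.c {a} (X ⊓ Zᶜ))ᶜ with hF
  have cF : B.c {a} F = F := c_compl hB fa (c_idem hB fa _)
  have hXF : X ⊓ F ≤ Z := by
    have : X ⊓ F ⊓ Zᶜ ≤ ⊥ := by
      have i1 : X ⊓ F ⊓ Zᶜ ≤ B.c {a} (X ⊓ Zᶜ) :=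
        le_trans (le_inf (inf_le_left.trans inf_le_left) inf_le_right) (hB.le_c _ _ fa)
      have i2 : X ⊓ F ⊓ Zᶜ ≤ F := inf_le_left.trans inf_le_right
      exact (le_inf i1 i2).trans (by rw [hF, inf_compl_self])
    rw [← compl_compl Z, le_compl_iff_disjoint_right, disjoint_iff]
    exact eq_bot_iff.2 this
  have gen : ∀ W : B.carrier, B.c {a} X ≤ B.c {a} (X ⊓ W) →
      B.c {a} X ⊓ F ≤ B.c {a} (Z ⊓ W) := by
    intro W hW
    refine (inf_le_inf_right F hW).trans ?_
    rw [← c_inf hB fa _ cF]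
    apply c_mono hB fa
    refine le_inf (le_trans ?_ hXF) (inf_le_left.trans inf_le_right)
    exact inf_le_inf_right _ inf_le_left
  rw [eq_bot_iff]
  exact (le_inf (gen _ h1) (gen _ h2)).trans (key hB hab hY hZ hd).le

end Alg

/-! ### The relations -/

section Rel

variable {α : Type u}

/-- Sequences almost equal to `i ↦ (i,0)`. -/
def W : Set (α → α × ℤ) := {q | {i | q i ≠ (i, 0)}.Finite}

/-- The sum of the second coordinates. -/
noncomputable def S (q : α → α × ℤ) : ℤ := ∑ᶠ i, (q i).2

/-- The generator. -/
def X (H : Set ℤ) : Set (α → α × ℤ) := {q | q ∈ W ∧ (∀ i, (q i).1 = i) ∧ S q ∈ H}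

/-- Back-and-forth relation on `W`. -/
structure R (H K : Set ℤ) (q r : α → α × ℤ) : Prop where
  mem : q ∈ W
  mem' : r ∈ W
  sort : ∀ i, (q i).1 = (r i).1
  eqs : ∀ i j, q i = q j ↔ r i = r j
  rel : ∀ τ, FinSupp τ → (q ∘ τ ∈ X H ↔ r ∘ τ ∈ X K)

theorem R.symm {H K : Set ℤ} {q r : α → α × ℤ} (h : R H K q r) : R K H r q :=
  ⟨h.mem', h.mem, fun i => (h.sort i).symm, fun i j => (h.eqs i j).symm,
    fun τ hτ => (h.rel τ hτ).symm⟩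

theorem W_of_diff {q r : α → α × ℤ} (hq : q ∈ W) (h : {i | r i ≠ q i}.Finite) : r ∈ W := by
  refine (h.union hq).subset ?_
  intro i hi
  by_contra hh
  simp only [Set.mem_union, Set.mem_ofPred_eq, not_or, not_not] at hh
  exact hi (hh.1.trans hh.2)

theorem W_comp {q : α → α × ℤ} (hq : q ∈ W) {τ : α → α} (h : FinSupp τ) : q ∘ τ ∈ W := by
  apply W_of_diff hq
  refine h.subset ?_
  intro i hi h'
  exact hi (by simp [h'])

theorem W_of_comp {q : α → α × ℤ} {τ : α → α} (h : FinSupp τ) (hq : q ∘ τ ∈ W) : q ∈ W := by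
  apply W_of_diff hq
  refine h.subset ?_
  intro i hi h'
  exact hi (by simp [h'])

theorem W_update [DecidableEq α] {q : α → α × ℤ} (hq : q ∈ W) (k : α) (u : α × ℤ) :
    update q k u ∈ W := by
  apply W_of_diff hq
  refine (Set.finite_singleton k).subset ?_
  intro i hi
  by_contra h
  exact hi (update_of_ne h _ _)

theorem R.comp {H K : Set ℤ} {q r : α → α × ℤ} (h : R H K q r) {σ : α → α} (hσ : FinSupp σ) :
    R H K (q ∘ σ) (r ∘ σ) :=
  ⟨W_comp h.mem hσ, W_comp h.mem' hσ, fun i => h.sort _, fun i j => h.eqs _ _,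
    fun τ hτ => h.rel (σ ∘ τ) (finSupp_comp hσ hτ)⟩

theorem S_update [DecidableEq α] {q : α → α × ℤ} (hq : q ∈ W) (k : α) (u : α × ℤ) :
    S (update q k u) = u.2 + (S q - (q k).2) := by
  have hsupp : ∀ r : α → α × ℤ, r ∈ W → (Function.support fun i => (r i).2).Finite := by
    intro r hr
    refine Set.Finite.subset hr ?_
    intro i hi h
    apply hi
    simp only [h]
  have e : ∀ i, (update q k u i).2 = (q i).2 + (Pi.single k (u.2 - (q k).2) : α → ℤ) i := by
    intro i
    by_cases h : i = k
    · subst h; simp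
    · simp [h]
  unfold S
  rw [finsum_congr e, finsum_add_distrib (hsupp q hq)]
  · have : ∑ᶠ i, (Pi.single k (u.2 - (q k).2) : α → ℤ) i = u.2 - (q k).2 := by
      rw [finsum_eq_single _ k]
      · simp
      · intro i hi; simp [hi]
    rw [this]; ring
  · refine (Set.finite_singleton k).subset ?_
    intro i hi
    by_contra h
    apply hi
    simp only [Set.mem_singleton_iff] at h
    simp [h]

theorem S_comp {q : α → α × ℤ} {τ : α → α} (h : Function.Bijective τ) : S (q ∘ τ) = S q :=
  finsum_comp_equiv (Equiv.ofBijective τ h) (f := fun i => (q i).2)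

/-- One-point extension. -/
theorem R.ext1 [DecidableEq α] {H K : Set ℤ} (hK0 : K.Nonempty) (hK1 : Kᶜ.Nonempty)
    {q r : α → α × ℤ} (h : R H K q r) (k : α) (u : α × ℤ) :
    ∃ v, R H K (update q k u) (update r k v) := by
  by_cases h1 : ∃ j, j ≠ k ∧ q j = u
  · obtain ⟨j, hj, rfl⟩ := h1
    refine ⟨r j, ?_⟩
    have e : ∀ q : α → α × ℤ, update q k (q j) = q ∘ repl k j := by
      intro q
      funext i
      by_cases hi : i = k
      · subst hi; simp [repl_self]
      · simp [hi, repl_ne hi]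
    rw [e, e]
    exact h.comp (finSupp_repl k j)
  have h1' : ∀ j, j ≠ k → q j ≠ u := fun j hj e => h1 ⟨j, hj, e⟩
  -- a general criterion
  have crit : ∀ v : α × ℤ, v.1 = u.1 → (∀ j, j ≠ k → r j ≠ v) →
      (∀ τ, FinSupp τ → (update q k u ∘ τ ∈ X H ↔ update r k v ∘ τ ∈ X K)) →
      R H K (update q k u) (update r k v) := by
    intro v hv hn hx
    refine ⟨W_update h.mem _ _, W_update h.mem' _ _, ?_, ?_, hx⟩
    · intro i
      by_cases hi : i = k
      · subst hi; simp [hv]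
      · simp [hi, h.sort]
    · intro i j
      by_cases hi : i = k <;> by_cases hj : j = k
      · subst hi; subst hj; simp
      · subst hi
        simp only [update_self, update_of_ne hj]
        exact ⟨fun e => absurd e.symm (h1' j hj), fun e => absurd e.symm (hn j hj)⟩
      · subst hj
        simp only [update_self, update_of_ne hi]
        exact ⟨fun e => absurd e (h1' i hi), fun e => absurd e (hn i hi)⟩
      · simp only [update_of_ne hi, update_of_ne hj]
        exact h.eqs i j
  have inj : ∀ (q : α → α × ℤ) (τ : α → α), FinSupp τ → (∀ i, (q (τ i)).1 = i) →
      Function.Bijective τ ∧ ∀ i j, (q i).1 = (q j).1 → i = j := by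
    intro q τ hτ hs
    have hi : Function.Injective τ := by
      intro i j e
      rw [← hs i, ← hs j, e]
    have hsu := FinSupp.surj hτ hi
    refine ⟨⟨hi, hsu⟩, ?_⟩
    intro i j e
    obtain ⟨i, rfl⟩ := hsu i
    obtain ⟨j, rfl⟩ := hsu j
    rw [hs, hs] at e
    rw [e]
  have sortu : ∀ v : α × ℤ, v.1 = u.1 → ∀ i, (update q k u i).1 = (update r k v i).1 := by
    intro v hv i
    by_cases hi : i = k
    · subst hi; simp [hv]
    · simp [hi, h.sort]
  by_cases h2 : ∃ j, j ≠ k ∧ (q j).1 = u.1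
  · obtain ⟨j, hj, hju⟩ := h2
    have hfin : {i | (r i).1 = u.1}.Finite := by
      refine (h.mem'.union (Set.finite_singleton u.1)).subset ?_
      intro i hi
      by_contra hh
      simp only [Set.mem_union, Set.mem_ofPred_eq, Set.mem_singleton_iff, not_or, not_not] at hh
      apply hh.2
      have hi' : (r i).1 = u.1 := hi
      rw [hh.1] at hi'
      exact hi'
    obtain ⟨n, hn⟩ := (hfin.image (fun i => (r i).2)).exists_notMem
    refine ⟨(u.1, n), crit _ rfl ?_ ?_⟩
    · intro i _ e
      apply hn
      exact ⟨i, by simp [e], by simp [e]⟩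
    · intro τ hτ
      constructor
      · intro hx
        exact absurd ((inj _ τ hτ hx.2.1).2 j k (by simp [hj, hju])) hj
      · intro hx
        exact absurd ((inj _ τ hτ hx.2.1).2 j k (by simp [hj, ← h.sort, hju])) hj
  · have h2' : ∀ j, j ≠ k → (q j).1 ≠ u.1 := fun j hj e => h2 ⟨j, hj, e⟩
    have : ∃ n : ℤ, (S (update q k u) ∈ H ↔ S (update r k (u.1, n)) ∈ K) := by
      obtain ⟨a, ha⟩ := hK0
      obtain ⟨b, hb⟩ := hK1
      by_cases hH : S (update q k u) ∈ H
      · refine ⟨a - (S r - (r k).2), ?_⟩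
        rw [S_update h.mem']
        simpa [hH] using ha
      · refine ⟨b - (S r - (r k).2), ?_⟩
        rw [S_update h.mem']
        simpa [hH] using hb
    obtain ⟨n, hn⟩ := this
    refine ⟨(u.1, n), crit _ rfl ?_ ?_⟩
    · intro j hj e
      apply h2' j hj
      rw [h.sort, e]
    · intro τ hτ
      have hs := sortu (u.1, n) rfl
      constructor
      · intro hx
        refine ⟨W_comp (W_update h.mem' _ _) hτ, ?_, ?_⟩
        · intro i
          have := hx.2.1 i
          simp only [Function.comp] at this ⊢
          rw [← hs, this]
        · have hb := (inj _ τ hτ hx.2.1).1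
          have := hx.2.2
          rw [S_comp hb] at this ⊢
          exact hn.1 this
      · intro hx
        refine ⟨W_comp (W_update h.mem _ _) hτ, ?_, ?_⟩
        · intro i
          have := hx.2.1 i
          simp only [Function.comp] at this ⊢
          rw [hs, this]
        · have hb := (inj _ τ hτ hx.2.1).1
          have := hx.2.2
          rw [S_comp hb] at this ⊢
          exact hn.2 this

theorem R.ext {H K : Set ℤ} (hK0 : K.Nonempty) (hK1 : Kᶜ.Nonempty)
    {q r : α → α × ℤ} (h : R H K q r) {Γ : Set α} (hΓ : Γ.Finite) :
    ∀ t : α → α × ℤ, (∀ j ∉ Γ, t j = q j) → ∃ t', R H K t t' ∧ ∀ j ∉ Γ, t' j = r j := by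
  classical
  induction Γ, hΓ using Set.Finite.induction_on with
  | empty =>
    intro t ht
    have : t = q := funext fun j => ht j (by simp)
    subst this
    exact ⟨r, h, fun _ _ => rfl⟩
  | @insert k Γ _ _ ih =>
    intro t ht
    obtain ⟨t', h', ht'⟩ := ih (update t k (q k)) (by
      intro j hj
      by_cases hk : j = k
      · subst hk; simp
      · simp only [update_of_ne hk]
        exact ht j (by simp [hk, hj]))
    obtain ⟨v, hv⟩ := h'.ext1 hK0 hK1 k (t k)
    refine ⟨update t' k v, ?_, ?_⟩
    · simpa using hv
    · intro j hj
      simp only [Set.mem_insert_iff, not_or] at hj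
      rw [update_of_ne hj.1]
      exact ht' j hj.2

theorem R.base {H K : Set ℤ} (hH : (0 : ℤ) ∈ H) (hK : (0 : ℤ) ∈ K) :
    R H K (fun i : α => (i, (0 : ℤ))) (fun i => (i, 0)) := by
  have hW : (fun i : α => (i, (0 : ℤ))) ∈ W (α := α) := by simp [W]
  refine ⟨hW, hW, fun _ => rfl, fun _ _ => Iff.rfl, ?_⟩
  intro τ hτ
  simp [X, S, Function.comp_def, hH, hK]

/-- The full relation. -/
def E (H K : Set ℤ) (q r : α → α × ℤ) : Prop := R H K q r ∨ (q = r ∧ q ∉ W)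

theorem E.symm {H K : Set ℤ} {q r : α → α × ℤ} (h : E H K q r) : E K H r q := by
  rcases h with h | ⟨rfl, h⟩
  · exact Or.inl h.symm
  · exact Or.inr ⟨rfl, h⟩

theorem E.comp {H K : Set ℤ} {q r : α → α × ℤ} (h : E H K q r) {σ : α → α} (hσ : FinSupp σ) :
    E H K (q ∘ σ) (r ∘ σ) := by
  rcases h with h | ⟨rfl, h⟩
  · exact Or.inl (h.comp hσ)
  · exact Or.inr ⟨rfl, fun h' => h (W_of_comp hσ h')⟩

theorem E.eqs {H K : Set ℤ} {q r : α → α × ℤ} (h : E H K q r) (i j : α) :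
    q i = q j ↔ r i = r j := by
  rcases h with h | ⟨rfl, h⟩
  · exact h.eqs i j
  · exact Iff.rfl

theorem E.gen {H K : Set ℤ} {q r : α → α × ℤ} (h : E H K q r) : q ∈ X H ↔ r ∈ X K := by
  rcases h with h | ⟨rfl, h⟩
  · exact h.rel id finSupp_id
  · exact ⟨fun h' => absurd h'.1 h, fun h' => absurd h'.1 h⟩

theorem E.ext {H K : Set ℤ} (hK0 : K.Nonempty) (hK1 : Kᶜ.Nonempty)
    {q r : α → α × ℤ} (h : E H K q r) {Γ : Set α} (hΓ : Γ.Finite)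
    (t : α → α × ℤ) (ht : ∀ j ∉ Γ, t j = q j) : ∃ t', E H K t t' ∧ ∀ j ∉ Γ, t' j = r j := by
  rcases h with h | ⟨rfl, h⟩
  · obtain ⟨t', h', e⟩ := h.ext hK0 hK1 hΓ t ht
    exact ⟨t', Or.inl h', e⟩
  · refine ⟨t, Or.inr ⟨rfl, ?_⟩, ht⟩
    intro h'
    apply h
    apply W_of_diff h'
    refine hΓ.subset ?_
    intro i hi
    by_contra hh
    exact hi (ht i hh).symm

theorem E.total {H K : Set ℤ} (hH : (0 : ℤ) ∈ H) (hK : (0 : ℤ) ∈ K) (hK1 : Kᶜ.Nonempty)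
    (q : α → α × ℤ) : ∃ r, E H K q r := by
  by_cases h : q ∈ W
  · obtain ⟨r, hr, -⟩ := (R.base (α := α) hH hK).ext ⟨0, hK⟩ hK1 h q (by
      intro j hj
      simpa using hj)
    exact ⟨r, Or.inl hr⟩
  · exact ⟨q, Or.inr ⟨rfl, h⟩⟩

end Rel

/-! ### The algebras -/

section Algebras

variable (α : Type u)

/-- The subalgebra of pairs of sets respecting `E`. -/
def sub (H K : Set ℤ) : BooleanSubalgebra (Set (α → α × ℤ) × Set (α → α × ℤ)) where
  carrier := {P | ∀ q r, E H K q r → (q ∈ P.1 ↔ r ∈ P.2)}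
  supClosed' := by
    intro P hP Q hQ q r h
    exact or_congr (hP q r h) (hQ q r h)
  infClosed' := by
    intro P hP Q hQ q r h
    exact and_congr (hP q r h) (hQ q r h)
  compl_mem' := by
    intro P hP q r h
    exact not_congr (hP q r h)
  bot_mem' := by
    intro q r h
    exact Iff.rfl

/-- The base set algebra. -/
abbrev A : QPEA α := setQPEA α (α × ℤ)

open Classical in
/-- The common subalgebra. -/
noncomputable def A0 (H K : Set ℤ) (hH : (0 : ℤ) ∈ H) (hK : (0 : ℤ) ∈ K)
    (hH1 : Hᶜ.Nonempty) (hK1 : Kᶜ.Nonempty) : QPEA α where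
  carrier := sub α H K
  c := fun Γ P => if hΓ : Γ.Finite then
    ⟨((A α).c Γ P.1.1, (A α).c Γ P.1.2), by
      intro q r h
      constructor
      · rintro ⟨t, ht, e⟩
        obtain ⟨t', h', e'⟩ := h.ext ⟨0, hK⟩ hK1 hΓ t e
        exact ⟨t', (P.2 t t' h').1 ht, e'⟩
      · rintro ⟨t, ht, e⟩
        obtain ⟨t', h', e'⟩ := h.symm.ext ⟨0, hH⟩ hH1 hΓ t e
        exact ⟨t', (P.2 t' t h'.symm).2 ht, e'⟩⟩ else P
  s := fun τ P => if hτ : FinSupp τ then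
    ⟨((A α).s τ P.1.1, (A α).s τ P.1.2), by
      intro q r h
      exact P.2 _ _ (h.comp hτ)⟩ else P
  d := fun i j => ⟨((A α).d i j, (A α).d i j), by
      intro q r h
      exact h.eqs i j⟩

variable {H K : Set ℤ} (hH : (0 : ℤ) ∈ H) (hK : (0 : ℤ) ∈ K)
    (hH1 : Hᶜ.Nonempty) (hK1 : Kᶜ.Nonempty)

theorem hom1 : IsQPEAHom (A0 α H K hH hK hH1 hK1) (A α) (fun P => P.1.1) where
  map_sup _ _ := rfl
  map_inf _ _ := rfl
  map_compl _ := rfl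
  map_bot := rfl
  map_top := rfl
  map_c Γ P hΓ := by
    have hΓ' : Γ.Finite := hΓ
    exact (congrArg (fun z : sub α H K => z.1.1) (dif_pos hΓ'))
  map_s τ P hτ := by
    exact (congrArg (fun z : sub α H K => z.1.1) (dif_pos hτ))
  map_d _ _ := rfl

theorem hom2 : IsQPEAHom (A0 α H K hH hK hH1 hK1) (A α) (fun P => P.1.2) where
  map_sup _ _ := rfl
  map_inf _ _ := rfl
  map_compl _ := rfl
  map_bot := rfl
  map_top := rfl
  map_c Γ P hΓ := by
    have hΓ' : Γ.Finite := hΓ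
    exact (congrArg (fun z : sub α H K => z.1.2) (dif_pos hΓ'))
  map_s τ P hτ := by
    exact (congrArg (fun z : sub α H K => z.1.2) (dif_pos hτ))
  map_d _ _ := rfl

theorem inj1 : Function.Injective
    (fun P : (A0 α H K hH hK hH1 hK1).carrier => P.1.1) := by
  intro P Q h
  have h' : P.1.1 = Q.1.1 := h
  apply Subtype.ext
  apply Prod.ext h'
  ext r
  obtain ⟨q, hq⟩ := E.total (α := α) hK hH hH1 r
  rw [← P.2 q r hq.symm, ← Q.2 q r hq.symm, h']

theorem inj2 : Function.Injective
    (fun P : (A0 α H K hH hK hH1 hK1).carrier => P.1.2) := by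
  intro P Q h
  have h' : P.1.2 = Q.1.2 := h
  apply Subtype.ext
  refine Prod.ext ?_ h'
  ext r
  obtain ⟨q, hq⟩ := E.total (α := α) hH hK hK1 r
  rw [P.2 r q hq, Q.2 r q hq, h']

/-- Anything embeddable in a set algebra is representable. -/
theorem rep_of_hom {B : QPEA α} {U : Type u} (f : B.carrier → (setQPEA α U).carrier)
    (hf : IsQPEAHom B (setQPEA α U) f) (hi : Function.Injective f) : IsRepresentableQPEA B := by
  refine ⟨PUnit, fun _ => U, fun x _ => f x, ?_, ?_⟩
  · constructor
    · intro x y; funext i; exact hf.map_sup x y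
    · intro x y; funext i; exact hf.map_inf x y
    · intro x; funext i; exact hf.map_compl x
    · funext i; exact hf.map_bot
    · funext i; exact hf.map_top
    · intro Γ x h; funext i; exact hf.map_c Γ x h
    · intro Γ x h; funext i; exact hf.map_s Γ x h
    · intro j k; funext i; exact hf.map_d j k
  · intro x y h
    exact hi (congrFun h PUnit.unit)

theorem rep_A : IsRepresentableQPEA (A α) :=
  rep_of_hom α (U := α × ℤ) id
    ⟨fun _ _ => rfl, fun _ _ => rfl, fun _ => rfl, rfl, rfl, fun _ _ _ => rfl,
      fun _ _ _ => rfl, fun _ _ => rfl⟩ Function.injective_id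

end Algebras

theorem hom_mono {α : Type u} {A B : QPEA α} {f : A.carrier → B.carrier} (hf : IsQPEAHom A B f)
    {x y : A.carrier} (h : x ≤ y) : f x ≤ f y := by
  rw [← inf_eq_left, ← hf.map_inf, inf_eq_left.2 h]

end QPAux

open QPAux in
/-- Any variety `K` with `RQPEA_α ⊆ K ⊆ QPEA_α` fails to have the
amalgamation property with respect to `QPEA_α`; in particular `RQPEA_α` and `QPEA_α`
themselves fail to have the amalgamation property. -/
theorem no_amalgamation_QPEA {α : Type u} [Infinite α]
    (K : QPEA α → Prop)
    -- K ⊆ QPEA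
    (hKsub : ∀ A, K A → IsQPEA A)
    -- K is closed under homomorphic images
    (hH : ∀ A B : QPEA α, K A → IsQPEA B →
      (∃ f : A.carrier → B.carrier, IsQPEAHom A B f ∧ Function.Surjective f) → K B)
    -- K is closed under subalgebras
    (hS : ∀ A B : QPEA α, K A → IsQPEA B →
      (∃ f : B.carrier → A.carrier, IsQPEAHom B A f ∧ Function.Injective f) → K B)
    -- K is closed under products
    (hP : ∀ (ι : Type u) (A : ι → QPEA α), (∀ i, K (A i)) → K (prodQPEA A))
    -- RQPEA ⊆ K
    (hR : ∀ A : QPEA α, IsRepresentableQPEA A → K A) :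
    ∃ (A₀ A₁ A₂ : QPEA α), K A₀ ∧ K A₁ ∧ K A₂ ∧
      ∃ (i₁ : A₀.carrier → A₁.carrier) (i₂ : A₀.carrier → A₂.carrier),
        IsQPEAHom A₀ A₁ i₁ ∧ Function.Injective i₁ ∧
        IsQPEAHom A₀ A₂ i₂ ∧ Function.Injective i₂ ∧
        ¬ ∃ (B : QPEA α) (m₁ : A₁.carrier → B.carrier) (m₂ : A₂.carrier → B.carrier),
            IsQPEA B ∧ IsQPEAHom A₁ B m₁ ∧ Function.Injective m₁ ∧
            IsQPEAHom A₂ B m₂ ∧ Function.Injective m₂ ∧ m₁ ∘ i₁ = m₂ ∘ i₂ := by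

  classical
  obtain ⟨a, b, hab⟩ := exists_pair_ne α
  have hH : (0 : ℤ) ∈ ({0, 1} : Set ℤ) := by simp
  have hK : (0 : ℤ) ∈ ({0} : Set ℤ) := by simp
  have hH1 : (({0, 1} : Set ℤ)ᶜ).Nonempty := ⟨2, by simp⟩
  have hK1 : (({0} : Set ℤ)ᶜ).Nonempty := ⟨2, by simp⟩
  refine ⟨A0 α {0, 1} {0} hH hK hH1 hK1, A α, A α,
    hR _ (rep_of_hom α _ (hom1 α hH hK hH1 hK1) (inj1 α hH hK hH1 hK1)),
    hR _ (rep_A α), hR _ (rep_A α), fun P => P.1.1, fun P => P.1.2,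
    hom1 α hH hK hH1 hK1, inj1 α hH hK hH1 hK1, hom2 α hH hK hH1 hK1, inj2 α hH hK hH1 hK1, ?_⟩
  rintro ⟨B, m₁, m₂, hB, h₁, -, h₂, i₂, hcomp⟩
  have fa : FinSet ({a} : Set α) := Set.finite_singleton a
  have fb : FinSet ({b} : Set α) := Set.finite_singleton b
  have hX : m₁ (X {0, 1}) = m₂ (X {0}) :=
    congrFun hcomp ⟨(X {0, 1}, X {0}), fun q r h => h.gen⟩
  let Y : (A α).carrier := {q : α → α × ℤ | Even (q a).2}
  let Z : (A α).carrier := {q : α → α × ℤ | q a = (a, 0)}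
  let X₁ : (A α).carrier := X {0, 1}
  let X₂ : (A α).carrier := X {0}
  have cY : (A α).c {b} Y = Y := by
    refine Set.ext (α := α → α × ℤ) fun q => ?_
    constructor
    · rintro ⟨t, ht, e⟩
      have := e a (by simpa using hab)
      change Even (q a).2
      rw [← this]; exact ht
    · intro h; exact ⟨q, h, fun _ _ => rfl⟩
  have cZ : (A α).c {b} Z = Z := by
    refine Set.ext (α := α → α × ℤ) fun q => ?_
    constructor
    · rintro ⟨t, ht, e⟩
      have := e a (by simpa using hab)
      change q a = (a, 0)
      rw [← this]; exact ht
    · intro h; exact ⟨q, h, fun _ _ => rfl⟩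
  have dZ : Z ⊓ (A α).s (repl a b) Z ≤ (A α).d a b := by
    rintro q ⟨h1, h2⟩
    have h1' : q a = (a, 0) := h1
    have h2' : q (repl a b a) = (a, 0) := h2
    rw [repl_self] at h2'
    exact h1'.trans h2'.symm
  -- sections of `X₁` contain both an even and an odd point
  have split : ∀ t ∈ X (α := α) {0, 1}, ∀ n : ℤ, ∃ t' ∈ X (α := α) {0, 1},
      (∀ j ∉ ({a} : Set α), t' j = t j) ∧ (Even (t' a).2 ↔ Even n) := by
    intro t ht n
    have hS : ∀ e : ℤ, S (update t a (a, e - (S t - (t a).2))) = e := by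
      intro e; rw [S_update ht.1]; ring
    have mk : ∀ e ∈ ({0, 1} : Set ℤ), update t a (a, e - (S t - (t a).2)) ∈ X (α := α) {0, 1} := by
      intro e he
      refine ⟨W_update ht.1 _ _, ?_, by rw [hS]; exact he⟩
      intro i
      by_cases hi : i = a
      · subst hi; simp
      · simp [hi, ht.2.1]
    have off : ∀ v, ∀ j ∉ ({a} : Set α), update t a v j = t j := by
      intro v j hj
      exact update_of_ne hj _ _
    by_cases hp : Even (0 - (S t - (t a).2)) ↔ Even n
    · exact ⟨_, mk 0 (by simp), off _, by simpa using hp⟩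
    · refine ⟨_, mk 1 (by simp), off _, ?_⟩
      simp only [update_self]
      rw [show (1 : ℤ) - (S t - (t a).2) = (0 - (S t - (t a).2)) + 1 by ring, Int.even_add_one]
      tauto
  have l1 : (A α).c {a} X₁ ≤ (A α).c {a} (X₁ ⊓ Y) := by
    rintro q ⟨t, ht, e⟩
    obtain ⟨t', ht', e', hp⟩ := split t ht 0
    exact ⟨t', ⟨ht', hp.2 (by simp)⟩, fun j hj => (e' j hj).trans (e j hj)⟩
  have l2 : (A α).c {a} X₁ ≤ (A α).c {a} (X₁ ⊓ Yᶜ) := by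
    rintro q ⟨t, ht, e⟩
    obtain ⟨t', ht', e', hp⟩ := split t ht 1
    exact ⟨t', ⟨ht', fun h => absurd (hp.1 h) (by simp)⟩, fun j hj => (e' j hj).trans (e j hj)⟩
  have ne : (A α).c {a} X₂ ⊓ ((A α).c {a} (X₂ ⊓ Zᶜ))ᶜ ≠ ⊥ := by
    intro h
    let p : α → α × ℤ := fun i => (i, 0)
    have hpW : p ∈ W (α := α) := by simp [W, p]
    have hpS : S p = 0 := by simp [S, p]
    have hp : p ∈ ((A α).c {a} X₂ ⊓ ((A α).c {a} (X₂ ⊓ Zᶜ))ᶜ : Set (α → α × ℤ)) := by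
      refine ⟨⟨p, ⟨hpW, fun _ => rfl, by simp [hpS]⟩, fun _ _ => rfl⟩, ?_⟩
      rintro ⟨t, ⟨ht, hz⟩, e⟩
      apply hz
      change t a = (a, 0)
      have et : t = update p a (t a) := by
        funext j
        by_cases hj : j = a
        · subst hj; simp
        · rw [update_of_ne hj]; exact e j hj
      have h0 : S t = 0 := ht.2.2
      rw [et, S_update hpW, hpS] at h0
      have h0' : (t a).2 = 0 := by simpa [p] using h0
      exact Prod.ext (ht.2.1 a) h0'
    exact (le_of_eq h : _ ≤ _) hp
  have L1 := hom_mono h₁ l1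
  have L2 := hom_mono h₁ l2
  have D := hom_mono h₂ dZ
  rw [h₁.map_c _ _ fa, h₁.map_c _ _ fa, h₁.map_inf] at L1 L2
  rw [h₁.map_compl] at L2
  rw [h₂.map_inf, h₂.map_s _ _ (finSupp_repl a b), h₂.map_d] at D
  have CY : B.c {b} (m₁ Y) = m₁ Y := by rw [← h₁.map_c _ _ fb, cY]
  have CZ : B.c {b} (m₂ Z) = m₂ Z := by rw [← h₂.map_c _ _ fb, cZ]
  have fin := no_amalg hB hab CY CZ D L1 L2
  apply ne
  apply i₂
  rw [h₂.map_bot, ← fin, h₂.map_inf, h₂.map_compl, h₂.map_c _ _ fa, h₂.map_c _ _ fa,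
    h₂.map_inf, h₂.map_compl]
  change _ = B.c {a} (m₁ (X {0, 1})) ⊓ (B.c {a} (m₁ (X {0, 1}) ⊓ (m₂ Z)ᶜ))ᶜ
  rw [hX]
end

section
/- Let α be an infinite set (ordinal) and κ an infinite cardinal with κ ≤ |α|. Let ECA_{κ,α} be the class of κ-extended cylindric algebras of dimension α and RECA_{κ,α} the class of representable ones. Then any variety K (closed under homomorphic images, subalgebras and products) with RECA_{κ,α} ⊆ K ⊆ ECA_{κ,α} fails to have the amalgamation property with respect to ECA_{κ,α}: there exist A₀, A₁, A₂ ∈ K and injective homomorphisms i₁ : A₀ → A₁, i₂ : A₀ → A₂ admitting no B ∈ ECA_{κ,α} with injective homomorphisms m₁ : A₁ → B, m₂ : A₂ → B such that m₁ ∘ i₁ = m₂ ∘ i₂. -/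
universe u

open Cardinal Function Set

/-- `Γ ⊆_κ α` : a set of cardinality `< κ`. -/
def SmallSet {α : Type u} (κ : Cardinal.{u}) (Γ : Set α) : Prop := #Γ < κ

/-- `E ∈ N` : an equivalence relation all but `< κ` many of whose classes are singletons. -/
def SmallEquiv {α : Type u} (κ : Cardinal.{u}) (E : α → α → Prop) : Prop :=
  Equivalence E ∧ #{i | ∃ j, j ≠ i ∧ E i j} < κ

/-- The equivalence relation identifying exactly `i` and `j`. -/
def pairRel {α : Type u} (i j : α) : α → α → Prop :=
  fun a b => a = b ∨ (a = i ∧ b = j) ∨ (a = j ∧ b = i)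

/-- The similarity type of Lucas' κ-extended cylindric algebras of dimension `α`: a
Boolean algebra with cylindrifications `c_{(Γ)}` (`|Γ| < κ`) and generalized diagonal
constants `d_E` (`E ∈ N`). (The operations are total; the axioms below constrain them on
indices in `SmallSet κ` and `SmallEquiv κ` respectively.) -/
structure ECA (α : Type u) (κ : Cardinal.{u}) : Type (u + 1) where
  carrier : Type u
  [ba : BooleanAlgebra carrier]
  c : Set α → carrier → carrier
  d : (α → α → Prop) → carrier

attribute [instance] ECA.ba

/-- The axioms of `ECA_{κ,α}`, including that the reduct
`(A, +, ·, −, 0, 1, c_{({i})}, d_{ij})_{i,j<α}` is a cylindric algebra of dimension `α`. -/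
structure IsECA {α : Type u} {κ : Cardinal.{u}} (A : ECA α κ) : Prop where
  c_bot : ∀ Γ, SmallSet κ Γ → A.c Γ ⊥ = ⊥
  le_c : ∀ Γ x, SmallSet κ Γ → x ≤ A.c Γ x
  c_inf_c : ∀ Γ x y, SmallSet κ Γ → A.c Γ (x ⊓ A.c Γ y) = A.c Γ x ⊓ A.c Γ y
  c_c : ∀ Γ Δ x, SmallSet κ Γ → SmallSet κ Δ → A.c Γ (A.c Δ x) = A.c (Γ ∪ Δ) x
  d_id : A.d (· = ·) = ⊤
  c_d : ∀ Γ E, SmallSet κ Γ → SmallEquiv κ E →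
    A.c Γ (A.d E) = A.d (fun a b => (E a b ∧ a ∉ Γ ∧ b ∉ Γ) ∨ a = b)
  -- the cylindric reduct axioms
  d_refl : ∀ i : α, A.d (pairRel i i) = ⊤
  d_comp : ∀ i j k : α, i ≠ j → i ≠ k →
    A.d (pairRel j k) = A.c {i} (A.d (pairRel j i) ⊓ A.d (pairRel i k))
  c_d_inf : ∀ (i j : α) (x : A.carrier), i ≠ j →
    A.c {i} (A.d (pairRel i j) ⊓ x) ⊓ A.c {i} (A.d (pairRel i j) ⊓ xᶜ) = ⊥

/-- Homomorphisms of `ECA`s. -/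
structure IsECAHom {α : Type u} {κ : Cardinal.{u}} (A B : ECA α κ)
    (f : A.carrier → B.carrier) : Prop where
  map_sup : ∀ x y, f (x ⊔ y) = f x ⊔ f y
  map_inf : ∀ x y, f (x ⊓ y) = f x ⊓ f y
  map_compl : ∀ x, f xᶜ = (f x)ᶜ
  map_bot : f ⊥ = ⊥
  map_top : f ⊤ = ⊤
  map_c : ∀ Γ x, SmallSet κ Γ → f (A.c Γ x) = B.c Γ (f x)
  map_d : ∀ E, SmallEquiv κ E → f (A.d E) = B.d E

/-- The full set algebra on `ᵅU` in this signature. -/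
def setECA (α : Type u) (κ : Cardinal.{u}) (U : Type u) : ECA α κ where
  carrier := Set (α → U)
  c := fun Γ X => {s | ∃ t ∈ X, ∀ j ∉ Γ, t j = s j}
  d := fun E => {s | ∀ i j, E i j → s i = s j}

/-- The product of a family of `ECA`s. -/
def prodECA {α : Type u} {κ : Cardinal.{u}} {ι : Type u} (A : ι → ECA α κ) : ECA α κ where
  carrier := ∀ i, (A i).carrier
  c := fun Γ x i => (A i).c Γ (x i)
  d := fun E i => (A i).d E

/-- Representable κ-extended cylindric algebras: algebras embeddable into a product of
full set algebras. -/
def IsRepresentableECA {α : Type u} {κ : Cardinal.{u}} (A : ECA α κ) : Prop :=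
  ∃ (ι : Type u) (U : ι → Type u)
    (f : A.carrier → (prodECA (fun i => setECA α κ (U i))).carrier),
      IsECAHom A (prodECA (fun i => setECA α κ (U i))) f ∧ Function.Injective f

namespace ECAaux

section abstractPart
variable {α : Type u} {κ : Cardinal.{u}}

lemma smallSet_singleton (hκ : ℵ₀ ≤ κ) (i : α) : SmallSet κ ({i} : Set α) := by
  unfold SmallSet
  exact lt_of_lt_of_le (by simp) hκ

lemma smallEquiv_pair (hκ : ℵ₀ ≤ κ) (i j : α) : SmallEquiv κ (pairRel i j) := by
  refine ⟨⟨fun a => Or.inl rfl, ?_, ?_⟩, ?_⟩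
  · intro a b h; unfold pairRel at *; grind
  · intro a b c h h'; unfold pairRel at *; grind
  · refine lt_of_lt_of_le ?_ hκ
    rw [Cardinal.lt_aleph0_iff_set_finite]
    refine (Set.toFinite ({i, j} : Set α)).subset ?_
    rintro a ⟨b, hb, h⟩
    unfold pairRel at h
    simp only [Set.mem_insert_iff, Set.mem_singleton_iff]
    grind

lemma c_mono {B : ECA α κ} (hB : IsECA B) {Γ : Set α} (hΓ : SmallSet κ Γ) {x y : B.carrier}
    (h : x ≤ y) : B.c Γ x ≤ B.c Γ y := by
  have h1 : x ⊓ B.c Γ y = x := inf_eq_left.2 (h.trans (hB.le_c Γ y hΓ))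
  have h2 := hB.c_inf_c Γ x y hΓ
  rw [h1] at h2
  rw [h2]; exact inf_le_right

lemma c_idem {B : ECA α κ} (hB : IsECA B) {Γ : Set α} (hΓ : SmallSet κ Γ) (x : B.carrier) :
    B.c Γ (B.c Γ x) = B.c Γ x := by
  rw [hB.c_c Γ Γ x hΓ hΓ, Set.union_self]

lemma c_compl {B : ECA α κ} (hB : IsECA B) {Γ : Set α} (hΓ : SmallSet κ Γ) (x : B.carrier) :
    B.c Γ (B.c Γ x)ᶜ = (B.c Γ x)ᶜ := by
  apply le_antisymm _ (hB.le_c Γ _ hΓ)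
  have h := hB.c_inf_c Γ (B.c Γ x)ᶜ x hΓ
  rw [compl_inf_eq_bot, hB.c_bot Γ hΓ] at h
  exact le_compl_iff_disjoint_right.2 (disjoint_iff.2 h.symm)

lemma c_sup_le {B : ECA α κ} (hB : IsECA B) {Γ : Set α} (hΓ : SmallSet κ Γ) (x y : B.carrier) :
    B.c Γ (x ⊔ y) ≤ B.c Γ x ⊔ B.c Γ y := by
  have h : B.c Γ (B.c Γ x ⊔ B.c Γ y) = B.c Γ x ⊔ B.c Γ y := by
    have h1 : B.c Γ ((B.c Γ x)ᶜ ⊓ (B.c Γ y)ᶜ) = (B.c Γ x)ᶜ ⊓ (B.c Γ y)ᶜ := by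
      have := hB.c_inf_c Γ (B.c Γ x)ᶜ (B.c Γ y)ᶜ hΓ
      rwa [c_compl hB hΓ, c_compl hB hΓ] at this
    have h2 := c_compl hB hΓ ((B.c Γ x)ᶜ ⊓ (B.c Γ y)ᶜ)
    rw [h1] at h2
    simpa [compl_inf] using h2
  rw [← h]
  exact c_mono hB hΓ (sup_le_sup (hB.le_c Γ x hΓ) (hB.le_c Γ y hΓ))

lemma c_diag {B : ECA α κ} (hB : IsECA B) (hκ : ℵ₀ ≤ κ) (o l : α) :
    B.c {l} (B.d (pairRel o l)) = ⊤ := by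
  rw [hB.c_d _ _ (smallSet_singleton hκ l) (smallEquiv_pair hκ o l), ← hB.d_id]
  congr 1
  funext a b
  simp only [pairRel, Set.mem_singleton_iff, eq_iff_iff]
  grind

lemma meet_eq {B : ECA α κ} (hB : IsECA B) (hκ : ℵ₀ ≤ κ) (o l : α) (p q : B.carrier)
    (hp : B.c {l} p = p) (hq : B.c {l} q = q)
    (h : p ⊓ B.c {o} (B.d (pairRel o l) ⊓ q) = ⊥) : B.c {o} p ⊓ B.c {o} q = ⊥ := by
  have so := smallSet_singleton hκ o
  have sl := smallSet_singleton hκ l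
  have h1 : B.c {l} (B.c {o} (B.d (pairRel o l) ⊓ q)) = B.c {o} q := by
    rw [hB.c_c _ _ _ sl so, Set.union_comm, ← hB.c_c _ _ _ so sl]
    have := hB.c_inf_c {l} (B.d (pairRel o l)) q sl
    rw [hq, c_diag hB hκ, top_inf_eq] at this
    rw [this]
  have h2 := hB.c_inf_c {l} (B.c {o} (B.d (pairRel o l) ⊓ q)) p sl
  rw [hp, inf_comm, h, hB.c_bot _ sl, h1] at h2
  rw [← hB.c_inf_c _ _ _ so, inf_comm, ← h2, hB.c_bot _ so]

lemma no_B {B : ECA α κ} (hB : IsECA B) (hκ : ℵ₀ ≤ κ) (o l : α)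
    (w : ZMod 3 → B.carrier) (y e x f : B.carrier)
    (hw : ∀ i, B.c {l} (w i) = w i) (hy : B.c {l} y = y)
    (hy1 : e ⊓ y ⊓ B.c {o} (B.d (pairRel o l) ⊓ y) ≤ x)
    (hy2 : e ⊓ yᶜ ⊓ B.c {o} (B.d (pairRel o l) ⊓ yᶜ) ≤ x)
    (hww : ∀ i j, i ≠ j → w i ⊓ B.c {o} (B.d (pairRel o l) ⊓ w j) ≤ e ⊓ xᶜ)
    (hf : ∀ i, B.c {o} (w i) = f) : f = ⊥ := by
  have so := smallSet_singleton hκ o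
  have sl := smallSet_singleton hκ l
  have hy' : B.c {l} yᶜ = yᶜ := by
    have := c_compl hB sl y
    rwa [hy] at this
  have key : ∀ v : B.carrier, B.c {l} v = v →
      e ⊓ v ⊓ B.c {o} (B.d (pairRel o l) ⊓ v) ≤ x → ∀ i j, i ≠ j →
      B.c {o} (w i ⊓ v) ⊓ B.c {o} (w j ⊓ v) = ⊥ := by
    intro v hv hvx i j hij
    have cl : ∀ i, B.c {l} (w i ⊓ v) = w i ⊓ v := by
      intro i
      have := hB.c_inf_c {l} (w i) v sl
      rwa [hv, hw] at this
    apply meet_eq hB hκ o l _ _ (cl i) (cl j)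
    rw [← le_bot_iff]
    have a1 : B.c {o} (B.d (pairRel o l) ⊓ (w j ⊓ v)) ≤ B.c {o} (B.d (pairRel o l) ⊓ w j) :=
      c_mono hB so (inf_le_inf_left _ inf_le_left)
    have a2 : B.c {o} (B.d (pairRel o l) ⊓ (w j ⊓ v)) ≤ B.c {o} (B.d (pairRel o l) ⊓ v) :=
      c_mono hB so (inf_le_inf_left _ inf_le_right)
    have a3 := (inf_le_inf (inf_le_left : w i ⊓ v ≤ w i) a1).trans (hww i j hij)
    have a4 := (le_inf (le_inf (a3.trans inf_le_left) (inf_le_left.trans inf_le_right))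
      (inf_le_right.trans a2)).trans hvx
    calc _ ≤ x ⊓ xᶜ := le_inf a4 (a3.trans inf_le_right)
      _ = ⊥ := inf_compl_eq_bot
  have k1 := key y hy hy1
  have k2 := key yᶜ hy' hy2
  have hs : ∀ i, f ≤ B.c {o} (w i ⊓ y) ⊔ B.c {o} (w i ⊓ yᶜ) := by
    intro i
    rw [← hf i]
    refine le_trans (le_of_eq ?_) (c_sup_le hB so _ _)
    rw [← inf_sup_left, sup_compl_eq_top, inf_top_eq]
  generalize ha : (fun i => B.c {o} (w i ⊓ y)) = a at *
  generalize hb : (fun i => B.c {o} (w i ⊓ yᶜ)) = b at *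
  have ka : ∀ i j, i ≠ j → Disjoint (a i) (a j) := by
    intro i j hij; rw [← ha]; exact disjoint_iff.2 (k1 i j hij)
  have kb : ∀ i j, i ≠ j → Disjoint (b i) (b j) := by
    intro i j hij; rw [← hb]; exact disjoint_iff.2 (k2 i j hij)
  have hs' : ∀ i, f ≤ a i ⊔ b i := by intro i; rw [← ha, ← hb]; exact hs i
  have n01 : (0 : ZMod 3) ≠ 1 := by decide
  have n02 : (0 : ZMod 3) ≠ 2 := by decide
  have n12 : (1 : ZMod 3) ≠ 2 := by decide
  have sw : ∀ (p q : ZMod 3 → B.carrier), (∀ i, f ≤ p i ⊔ q i) →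
      (∀ i j, i ≠ j → Disjoint (p i) (p j)) → (∀ i j, i ≠ j → Disjoint (q i) (q j)) →
      f ⊓ p 0 = ⊥ := by
    intro p q h1 h2 h3
    have g : ∀ i, 0 ≠ i → f ⊓ p 0 ≤ q i := by
      intro i hi
      have : f ⊓ p 0 ≤ (p i ⊔ q i) ⊓ p 0 := inf_le_inf_right _ (h1 i)
      rw [inf_sup_right, inf_comm (p i), (h2 0 i hi).eq_bot, bot_sup_eq] at this
      exact this.trans inf_le_left
    exact le_bot_iff.1 ((h3 1 2 n12) (g 1 n01) (g 2 n02))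
  have s1 := sw a b hs' ka kb
  have s2 := sw b a (fun i => by rw [sup_comm]; exact hs' i) kb ka
  have := inf_eq_left.2 (hs' 0)
  rw [inf_sup_left, s1, s2, sup_bot_eq] at this
  exact this.symm

lemma hom_mono {A B : ECA α κ} {f : A.carrier → B.carrier} (hf : IsECAHom A B f)
    {x y : A.carrier} (h : x ≤ y) : f x ≤ f y := by
  rw [← inf_eq_left, ← hf.map_inf, inf_eq_left.2 h]

lemma zmod2 (c : ZMod 2) : ¬ c = 0 ↔ c = 1 := by revert c; decide

lemma no_amalg_abs {A₁ A₂ B : ECA α κ} (hB : IsECA B) (hκ : ℵ₀ ≤ κ) (o l : α)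
    (m₁ : A₁.carrier → B.carrier) (m₂ : A₂.carrier → B.carrier)
    (hm₁ : IsECAHom A₁ B m₁) (hm₂ : IsECAHom A₂ B m₂)
    (w : ZMod 3 → A₂.carrier) (y e x : A₁.carrier) (e' x' f : A₂.carrier)
    (he : m₁ e = m₂ e') (hx : m₁ x = m₂ x')
    (hw : ∀ i, A₂.c {l} (w i) = w i) (hy : A₁.c {l} y = y)
    (hy1 : e ⊓ y ⊓ A₁.c {o} (A₁.d (pairRel o l) ⊓ y) ≤ x)
    (hy2 : e ⊓ yᶜ ⊓ A₁.c {o} (A₁.d (pairRel o l) ⊓ yᶜ) ≤ x)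
    (hww : ∀ i j, i ≠ j → w i ⊓ A₂.c {o} (A₂.d (pairRel o l) ⊓ w j) ≤ e' ⊓ x'ᶜ)
    (hf : ∀ i, A₂.c {o} (w i) = f) : m₂ f = ⊥ := by
  have so := smallSet_singleton hκ o
  have sl := smallSet_singleton hκ l
  have sd := smallEquiv_pair hκ o l
  refine no_B hB hκ o l (fun i => m₂ (w i)) (m₁ y) (m₁ e) (m₁ x) (m₂ f) ?_ ?_ ?_ ?_ ?_ ?_
  · intro i
    rw [← hm₂.map_c _ _ sl, hw]
  · rw [← hm₁.map_c _ _ sl, hy]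
  · rw [← hm₁.map_d _ sd, ← hm₁.map_inf, ← hm₁.map_inf, ← hm₁.map_c _ _ so, ← hm₁.map_inf]
    exact hom_mono hm₁ hy1
  · rw [← hm₁.map_d _ sd, ← hm₁.map_compl, ← hm₁.map_inf, ← hm₁.map_inf, ← hm₁.map_c _ _ so,
      ← hm₁.map_inf]
    exact hom_mono hm₁ hy2
  · intro i j hij
    rw [he, hx, ← hm₂.map_d _ sd, ← hm₂.map_inf, ← hm₂.map_c _ _ so, ← hm₂.map_inf,
      ← hm₂.map_compl, ← hm₂.map_inf]
    exact hom_mono hm₂ (hww i j hij)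
  · intro i
    rw [← hm₂.map_c _ _ so, hf]

lemma setECA_rep (U : Type u) : IsRepresentableECA (setECA α κ U) := by
  refine ⟨PUnit, fun _ => U, fun X _ => X, ⟨?_, ?_, ?_, ?_, ?_, ?_, ?_⟩, ?_⟩
  all_goals first | (intros; rfl) | skip
  intro X Y h
  exact congrFun h PUnit.unit

lemma rep_of_emb {A : ECA α κ} (U : Type u) (g : A.carrier → (setECA α κ U).carrier)
    (hg : IsECAHom A (setECA α κ U) g) (hi : Function.Injective g) : IsRepresentableECA A := by
  refine ⟨PUnit, fun _ => U, fun X _ => g X, ⟨?_, ?_, ?_, ?_, ?_, ?_, ?_⟩, ?_⟩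
  · intro x y; funext _; exact hg.map_sup x y
  · intro x y; funext _; exact hg.map_inf x y
  · intro x; funext _; exact hg.map_compl x
  · funext _; exact hg.map_bot
  · funext _; exact hg.map_top
  · intro Γ x h; funext _; exact hg.map_c Γ x h
  · intro E h; funext _; exact hg.map_d E h
  · intro X Y h
    exact hi (congrFun h PUnit.unit)

end abstractPart

section bisim
variable {α : Type u}

/-- Extension property of a model. -/
def Good (U : Type u) (X : Set (α → U)) : Prop :=
  (∀ t ∈ X, Injective t) ∧
  ∀ (Γ : Set α), Γ.Nonempty → ∀ (t : α → U) (V : Type u) (s : α → V),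
    (∀ i j, i ∉ Γ → j ∉ Γ → (s i = s j ↔ t i = t j)) → ∀ β : Prop,
    ∃ t' : α → U, (∀ j ∉ Γ, t' j = t j) ∧ (∀ i j, s i = s j ↔ t' i = t' j) ∧
      (Injective s → (t' ∈ X ↔ β))

/-- The type of a sequence. -/
def ty {U : Type u} (X : Set (α → U)) (s : α → U) : (α → α → Prop) × Prop :=
  (fun i j => s i = s j, s ∈ X)

lemma ty_eq {U V : Type u} {X : Set (α → U)} {Y : Set (α → V)} {s : α → U} {t : α → V} :
    ty X s = ty Y t ↔ (∀ i j, s i = s j ↔ t i = t j) ∧ (s ∈ X ↔ t ∈ Y) := by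
  unfold ty
  rw [Prod.mk.injEq]
  simp [funext_iff]

lemma zig {U V : Type u} {X : Set (α → U)} {Y : Set (α → V)} (hX : Good U X) (hY : Good V Y)
    (Γ : Set α) (s s' : α → U) (t : α → V) (h : Γ.Nonempty → ∀ i j, i ∉ Γ → j ∉ Γ → (s i = s j ↔ t i = t j))
    (h0 : ¬ Γ.Nonempty → ty X s = ty Y t)
    (hs : ∀ j ∉ Γ, s' j = s j) :
    ∃ t' : α → V, (∀ j ∉ Γ, t' j = t j) ∧ ty X s' = ty Y t' := by
  by_cases hΓ : Γ.Nonempty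
  · obtain ⟨t', h1, h2, h3⟩ := hY.2 Γ hΓ t U s'
      (by intro i j hi hj; rw [hs i hi, hs j hj]; exact h hΓ i j hi hj) (s' ∈ X)
    refine ⟨t', h1, ty_eq.2 ⟨h2, ?_⟩⟩
    by_cases hi : Injective s'
    · exact (h3 hi).symm
    · have h4 : ¬ Injective t' := by
        intro h5; apply hi; intro i j hij
        exact h5 ((h2 i j).1 hij)
      exact ⟨fun h => (hi (hX.1 _ h)).elim, fun h => (h4 (hY.1 _ h)).elim⟩
  · have : s' = s := by
      funext j; exact hs j (fun hj => hΓ ⟨j, hj⟩)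
    exact ⟨t, fun _ _ => rfl, by rw [this]; exact h0 hΓ⟩

lemma zig' {U V : Type u} {X : Set (α → U)} {Y : Set (α → V)} (hX : Good U X) (hY : Good V Y)
    (Γ : Set α) (s s' : α → U) (t : α → V) (h : ty X s = ty Y t)
    (hs : ∀ j ∉ Γ, s' j = s j) :
    ∃ t' : α → V, (∀ j ∉ Γ, t' j = t j) ∧ ty X s' = ty Y t' :=
  zig hX hY Γ s s' t (fun _ i j _ _ => (ty_eq.1 h).1 i j) (fun _ => h) hs

lemma total [Nonempty α] {U V : Type u} [Nonempty V] {X : Set (α → U)} {Y : Set (α → V)}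
    (hX : Good U X) (hY : Good V Y) (s : α → U) : ∃ t : α → V, ty X s = ty Y t := by
  obtain ⟨t', -, h⟩ := zig hX hY Set.univ s s (fun _ => Classical.arbitrary V)
    (fun _ i j hi _ => (hi trivial).elim) (fun h => (h Set.univ_nonempty).elim) (fun _ _ => rfl)
  exact ⟨t', h⟩

/-- The algebra of sets of types. -/
def tyECA (α : Type u) (κ : Cardinal.{u}) {U : Type u} (X : Set (α → U)) : ECA α κ where
  carrier := Set (Set.range (ty X))
  c := fun Γ S => {p | ∃ s s', ty X s = p.1 ∧ (∀ j ∉ Γ, s' j = s j) ∧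
    (⟨ty X s', s', rfl⟩ : Set.range (ty X)) ∈ S}
  d := fun E => {p | ∀ i j, E i j → p.1.1 i j}

/-- The embedding of the algebra of types. -/
def emb {κ : Cardinal.{u}} {U V : Type u} (X : Set (α → U)) (Y : Set (α → V)) 
    (S : (tyECA α κ X).carrier) : (setECA α κ V).carrier :=
  {t : α → V | ∃ h : ty Y t ∈ Set.range (ty X), (⟨ty Y t, h⟩ : Set.range (ty X)) ∈ 
    (show Set (Set.range (ty X)) from S)}

lemma emb_hom [Nonempty α] {κ : Cardinal.{u}} {U V : Type u} [Nonempty U] [Nonempty V]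
    {X : Set (α → U)} {Y : Set (α → V)} (hX : Good U X) (hY : Good V Y) :
    IsECAHom (tyECA α κ X) (setECA α κ V) (emb X Y) ∧ Injective (emb (κ := κ) X Y) := by
  have tot : ∀ t : α → V, ty Y t ∈ Set.range (ty X) := by
    intro t
    obtain ⟨s, hs⟩ := total hY hX t
    exact ⟨s, hs.symm⟩
  let F : (tyECA α κ X).carrier → (setECA α κ V).carrier := fun S =>
    (fun t => (⟨ty Y t, tot t⟩ : Set.range (ty X))) ⁻¹' (show Set (Set.range (ty X)) from S)
  have embeq : emb (κ := κ) X Y = F := by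
    funext S
    refine Set.ext fun t => ?_
    exact ⟨fun ⟨_, h⟩ => h, fun h => ⟨_, h⟩⟩
  rw [embeq]
  refine ⟨⟨?_, ?_, ?_, ?_, ?_, ?_, ?_⟩, ?_⟩
  · intro x y; rfl
  · intro x y; rfl
  · intro x; rfl
  · rfl
  · rfl
  · intro Γ S _
    refine Set.ext fun t => ?_
    constructor
    · rintro ⟨s, s', h1, h2, h3⟩
      obtain ⟨t', h4, h5⟩ := zig' hX hY Γ s s' t h1 h2
      refine ⟨t', ?_, h4⟩
      have h6 : (⟨ty Y t', tot t'⟩ : Set.range (ty X)) = ⟨ty X s', s', rfl⟩ :=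
        Subtype.ext h5.symm
      show (⟨ty Y t', tot t'⟩ : Set.range (ty X)) ∈ (show Set (Set.range (ty X)) from S)
      rw [h6]; exact h3
    · rintro ⟨t', h1, h2⟩
      obtain ⟨s, hs⟩ := tot t
      obtain ⟨s', h4, h5⟩ := zig' hY hX Γ t t' s hs.symm h2
      refine ⟨s, s', hs, h4, ?_⟩
      have h6 : (⟨ty Y t', tot t'⟩ : Set.range (ty X)) = ⟨ty X s', s', rfl⟩ :=
        Subtype.ext h5
      rw [← h6]; exact h1
  · intro E _
    rfl
  · intro S T h
    refine Set.preimage_injective.2 ?_ h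
    rintro ⟨_, s, rfl⟩
    obtain ⟨t, ht⟩ := total hX hY s
    exact ⟨t, Subtype.ext ht.symm⟩

end bisim

section model
variable {α : Type u}

lemma exists_sum [DecidableEq α] (k : Type) [Field k] (Z : Type u) [AddCommGroup Z] [Module k Z] :
    ∃ p : (α → Z) →+ Z, ∀ i z, p (Pi.single i z) = z := by
  let φ : (α →₀ Z) →ₗ[k] (α → Z) := Finsupp.lcoeFun
  have hker : LinearMap.ker φ = ⊥ := by
    rw [LinearMap.ker_eq_bot']
    intro a h
    exact DFunLike.coe_injective h
  obtain ⟨g, hg⟩ := LinearMap.exists_leftInverse_of_injective φ hker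
  let p : (α → Z) →ₗ[k] Z := (Finsupp.lsum k (fun _ : α => LinearMap.id)) ∘ₗ g
  refine ⟨p.toAddMonoidHom, ?_⟩
  intro i z
  have h1 : g (Pi.single i z) = Finsupp.single i z := by
    have := LinearMap.congr_fun hg (Finsupp.single i z)
    simp only [LinearMap.comp_apply, LinearMap.id_apply] at this
    rw [← this]
    congr 1
    exact (Finsupp.single_eq_pi_single i z).symm
  simp [p, h1]

lemma two_single {V R : Type*} [CommRing R] [Nontrivial R] (a a' : V) (haa : a ≠ a') :
    (∀ x y : R, x + (Finsupp.single a (y - x) : V →₀ R) a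
      = y + (Finsupp.single a (y - x) : V →₀ R) a') ∧
    (∀ x y : R, ¬ x + (Finsupp.single a (y - x + 1) : V →₀ R) a
      = y + (Finsupp.single a (y - x + 1) : V →₀ R) a') := by
  classical
  refine ⟨fun x y => ?_, fun x y h => ?_⟩
  · rw [Finsupp.single_eq_same, Finsupp.single_apply, if_neg haa]
    ring
  · rw [Finsupp.single_eq_same, Finsupp.single_apply, if_neg haa] at h
    have : (1 : R) = 0 := by linear_combination h
    exact one_ne_zero this

lemma exists_model [Infinite α] [DecidableEq α] (o l : α) (hol : o ≠ l) (n : ℕ) [Fact n.Prime] :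
    ∃ (U Z : Type u) (χ : Z → U → ZMod n) (P : (α → U) → Z),
      (∀ z c (t : α → U), ∃ b, b ∉ Set.range t ∧ χ z b = c) ∧
      (∀ a a', a ≠ a' → ∀ β : Prop, ∃ z, χ z a = χ z a' ↔ β) ∧
      (∀ s t : α → U, (∀ j, j ≠ o → j ≠ l → s j = t j) → P s = P t) ∧
      (∀ (t : α → U) k, k ≠ o → k ≠ l → ∀ z, ∃ b, b ∉ Set.range t ∧ P (update t k b) = z) ∧
      (∀ t : α → U, ∃ g : α → U, Injective g ∧ ∀ i, g i ∉ Set.range t) ∧ Nonempty U := by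
  classical
  let U := Set α × ZMod n
  let Z := U →₀ ZMod n
  have : NeZero n := ⟨(Fact.out : n.Prime).ne_zero⟩
  have hU : #α < #U := by
    calc #α < #(Set α) := by rw [Cardinal.mk_set]; exact Cardinal.cantor _
      _ ≤ #U := Cardinal.mk_le_of_injective (f := fun m => ((m, 0) : U))
        (fun a b h => (Prod.mk.inj h).1)
  have hUinf : Infinite U := by
    rw [Cardinal.infinite_iff]
    exact (Cardinal.aleph0_le_mk α).trans hU.le
  have hZ : #(Z × U) = #U := by
    have h1 : #Z = #U := by
      have := Cardinal.mk_finsupp_lift_of_infinite U (ZMod n)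
      rw [this]
      simp only [Cardinal.lift_id']
      apply max_eq_left
      refine le_trans ?_ (Cardinal.aleph0_le_mk U)
      simp
    rw [Cardinal.mk_prod, Cardinal.lift_id, Cardinal.lift_id, h1]
    exact Cardinal.mul_eq_self (Cardinal.aleph0_le_mk U)
  obtain ⟨e⟩ := Cardinal.eq.1 hZ
  let π : U → Z := fun u => (e.symm u).1
  have hπ : ∀ z (t : α → U), ∃ b, b ∉ Set.range t ∧ π b = z := by
    intro z t
    by_contra hcon
    push Not at hcon
    have : ∀ u : U, e (z, u) ∈ Set.range t := by
      intro u; by_contra h; exact hcon _ h (by simp [π])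
    have h2 : #U ≤ #(Set.range t) := Cardinal.mk_le_of_injective (f := fun u => ⟨e (z, u), this u⟩)
      (by intro a b h; simpa using h)
    exact absurd (h2.trans Cardinal.mk_range_le) (not_le.2 hU)
  obtain ⟨p, hp⟩ := exists_sum (α := α) (ZMod n) Z
  let N : (α → U) → (α → Z) := fun s j => if j = o ∨ j = l then 0 else π (s j)
  refine ⟨U, Z, fun z u => u.2 + z u, fun s => p (N s), ?_, ?_, ?_, ?_, ?_, inferInstance⟩
  · intro z c t
    by_contra hcon
    push Not at hcon
    have h1 : ∀ m : Set α, ((m, c) : U) ∈ Set.range t ∪ (z.support : Set U) := by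
      intro m
      by_cases h : ((m, c) : U) ∈ Set.range t
      · exact Or.inl h
      · right
        have := hcon _ h
        simpa using this
    have h2 : #(Set α) ≤ #(Set.range t ∪ (z.support : Set U) : Set U) :=
      Cardinal.mk_le_of_injective (f := fun m => ⟨(m, c), h1 m⟩)
        (fun a b h => (Prod.mk.inj (Subtype.mk.inj h)).1)
    have h3 : #(Set.range t ∪ (z.support : Set U) : Set U) ≤ #α := by
      refine (Cardinal.mk_union_le _ _).trans ?_
      refine Cardinal.add_le_of_le (Cardinal.aleph0_le_mk α) Cardinal.mk_range_le ?_
      refine le_trans ?_ (Cardinal.aleph0_le_mk α)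
      exact (Cardinal.lt_aleph0_iff_set_finite.2 (Finset.finite_toSet _)).le
    have h4 : #α < #(Set α) := by rw [Cardinal.mk_set]; exact Cardinal.cantor _
    exact absurd (h2.trans h3) (not_le.2 h4)
  · intro a a' haa β
    obtain ⟨a1, a2⟩ := two_single (R := ZMod n) a a' haa
    by_cases hβ : β
    · exact ⟨Finsupp.single a (a'.2 - a.2), iff_of_true (a1 _ _) hβ⟩
    · exact ⟨Finsupp.single a (a'.2 - a.2 + 1), iff_of_false (a2 _ _) hβ⟩
  · intro s t h
    have : N s = N t := by
      funext j
      simp only [N]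
      split_ifs with hj
      · rfl
      · push Not at hj
        rw [h j hj.1 hj.2]
    simp only [this]
  · intro t k ho hl z
    obtain ⟨b, hb, hbz⟩ := hπ (z - p (update (N t) k 0)) t
    refine ⟨b, hb, ?_⟩
    have : N (update t k b) = update (N t) k 0 + Pi.single k (π b) := by
      funext j
      by_cases hj : j = k
      · subst hj; simp [N, ho, hl]
      · simp [N, hj]
    simp only [this, map_add, hp, hbz]
    abel
  · intro t
    have h1 : #α ≤ #((Set.range t)ᶜ : Set U) := by
      by_contra hcon
      have h2 := Cardinal.mk_sum_compl (Set.range t)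
      have h3 : #(Set.range t) + #((Set.range t)ᶜ : Set U) ≤ #α :=
        Cardinal.add_le_of_le (Cardinal.aleph0_le_mk α) Cardinal.mk_range_le (not_le.1 hcon).le
      rw [h2] at h3
      exact absurd h3 (not_le.2 hU)
    obtain ⟨f⟩ := h1
    exact ⟨fun i => (f i).1, fun i j h => f.injective (Subtype.ext h), fun i => (f i).2⟩

lemma good_model [Infinite α] [DecidableEq α] (o l : α) (hol : o ≠ l) {n : ℕ} [Fact n.Prime]
    {U Z : Type u} (χ : Z → U → ZMod n) (P : (α → U) → Z)
    (hA : ∀ z c (t : α → U), ∃ b, b ∉ Set.range t ∧ χ z b = c)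
    (hB : ∀ a a', a ≠ a' → ∀ β : Prop, ∃ z, χ z a = χ z a' ↔ β)
    (hC : ∀ s t : α → U, (∀ j, j ≠ o → j ≠ l → s j = t j) → P s = P t)
    (hD : ∀ (t : α → U) k, k ≠ o → k ≠ l → ∀ z, ∃ b, b ∉ Set.range t ∧ P (update t k b) = z)
    (hinj : ∀ t : α → U, ∃ g : α → U, Injective g ∧ ∀ i, g i ∉ Set.range t) :
    Good U {t | Injective t ∧ χ (P t) (t o) = χ (P t) (t l)} := by
  classical
  refine ⟨fun t h => h.1, ?_⟩
  intro Γ ⟨k, hk⟩ t V s hst β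
  have ext : ∃ t' : α → U, (∀ j ∉ Γ, t' j = t j) ∧ (∀ i j, s i = s j ↔ t' i = t' j) := by
    obtain ⟨g, hg, hgt⟩ := hinj t
    have : Nonempty α := ⟨o⟩
    let r : V → α := invFun s
    have hr : ∀ i, s (r (s i)) = s i := fun i => invFun_eq ⟨i, rfl⟩
    let q : V → U := fun v => if h : ∃ j, j ∉ Γ ∧ s j = v then t h.choose else g (r v)
    have hq : ∀ j, j ∉ Γ → q (s j) = t j := by
      intro j hj
      have h : ∃ j', j' ∉ Γ ∧ s j' = s j := ⟨j, hj, rfl⟩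
      simp only [q, dif_pos h]
      exact (hst _ _ h.choose_spec.1 hj).1 h.choose_spec.2
    refine ⟨fun i => q (s i), hq, fun i j => ⟨fun h => by simp only [h], fun h => ?_⟩⟩
    have cases : ∀ i, (∃ j, j ∉ Γ ∧ s j = s i) ∨ q (s i) = g (r (s i)) := by
      intro i
      by_cases h : ∃ j, j ∉ Γ ∧ s j = s i
      · exact Or.inl h
      · right; simp only [q, dif_neg h]
    simp only at h
    rcases cases i with ⟨i', hi', hi⟩ | hi <;> rcases cases j with ⟨j', hj', hj⟩ | hj
    · rw [← hi, ← hj, hq _ hi', hq _ hj'] at h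
      rw [← hi, ← hj]; exact (hst _ _ hi' hj').2 h
    · rw [← hi, hq _ hi', hj] at h
      exact (hgt _ ⟨i', h⟩).elim
    · rw [← hj, hq _ hj', hi] at h
      exact (hgt _ ⟨j', h.symm⟩).elim
    · rw [hi, hj] at h
      have := hg h
      rw [← hr i, ← hr j, this]
  obtain ⟨t', h1, h2⟩ := ext
  by_cases hs : Injective s
  swap
  · exact ⟨t', h1, h2, fun h => (hs h).elim⟩
  have ht' : Injective t' := fun i j h => hs ((h2 i j).2 h)
  have fin : ∃ b, b ∉ Set.range t' ∧ 
      (χ (P (update t' k b)) (update t' k b o) = χ (P (update t' k b)) (update t' k b l) ↔ β) := by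
    have hCk : ∀ b, k = o ∨ k = l → P (update t' k b) = P t' := by
      intro b hk
      apply hC
      intro j ho hl
      rw [update_of_ne]
      rintro rfl
      rcases hk with h | h
      · exact ho h
      · exact hl h
    have pick : ∀ c : ZMod n, ∃ c' : ZMod n, c' = c ↔ β := by
      intro c
      by_cases hβ : β
      · exact ⟨c, by simp [hβ]⟩
      · refine ⟨c + 1, by simp [hβ]⟩
    by_cases ho : k = o
    · subst ho
      obtain ⟨c, hc⟩ := pick (χ (P t') (t' l))
      obtain ⟨b, hb, hbc⟩ := hA (P t') c t'
      refine ⟨b, hb, ?_⟩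
      rw [hCk b (Or.inl rfl), update_self, update_of_ne hol.symm, hbc]
      exact hc
    by_cases hl : k = l
    · subst hl
      obtain ⟨c, hc⟩ := pick (χ (P t') (t' o))
      obtain ⟨b, hb, hbc⟩ := hA (P t') c t'
      refine ⟨b, hb, ?_⟩
      rw [hCk b (Or.inr rfl), update_self, update_of_ne hol, hbc, eq_comm]
      exact hc
    · obtain ⟨z, hz⟩ := hB (t' o) (t' l) (fun h => hol (ht' h)) β
      obtain ⟨b, hb, hbz⟩ := hD t' k ho hl z
      refine ⟨b, hb, ?_⟩
      rw [update_of_ne (Ne.symm ho), update_of_ne (Ne.symm hl), hbz]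
      exact hz
  obtain ⟨b, hb, hbβ⟩ := fin
  have hinj' : Injective (update t' k b) := by
    intro i j h
    by_cases hi : i = k <;> by_cases hj : j = k
    · rw [hi, hj]
    · subst hi
      rw [update_self, update_of_ne hj] at h
      exact (hb ⟨j, h.symm⟩).elim
    · subst hj
      rw [update_self, update_of_ne hi] at h
      exact (hb ⟨i, h⟩).elim
    · rw [update_of_ne hj, update_of_ne hi] at h
      exact ht' h
  refine ⟨update t' k b, ?_, ?_, ?_⟩
  · intro j hj
    rw [update_of_ne, h1 j hj]
    rintro rfl; exact hj hk
  · intro i j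
    rw [hs.eq_iff, hinj'.eq_iff]
  · intro _
    simp only [Set.mem_ofPred_eq, hbβ]
    exact ⟨fun h => h.2, fun h => ⟨hinj', h⟩⟩

end model

end ECAaux

/-- Any variety `K` with `RECA_{κ,α} ⊆ K ⊆ ECA_{κ,α}` fails to have the
amalgamation property with respect to `ECA_{κ,α}`. -/
theorem no_amalgamation_ECA {α : Type u} {κ : Cardinal.{u}} [Infinite α]
    (hκ : ℵ₀ ≤ κ) (hκα : κ ≤ #α)
    (K : ECA α κ → Prop)
    -- K ⊆ ECA
    (hKsub : ∀ A, K A → IsECA A)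
    -- K is closed under homomorphic images
    (hH : ∀ A B : ECA α κ, K A → IsECA B →
      (∃ f : A.carrier → B.carrier, IsECAHom A B f ∧ Function.Surjective f) → K B)
    -- K is closed under subalgebras
    (hS : ∀ A B : ECA α κ, K A → IsECA B →
      (∃ f : B.carrier → A.carrier, IsECAHom B A f ∧ Function.Injective f) → K B)
    -- K is closed under products
    (hP : ∀ (ι : Type u) (A : ι → ECA α κ), (∀ i, K (A i)) → K (prodECA A))
    -- RECA ⊆ K
    (hR : ∀ A : ECA α κ, IsRepresentableECA A → K A) :
    ∃ (A₀ A₁ A₂ : ECA α κ), K A₀ ∧ K A₁ ∧ K A₂ ∧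
      ∃ (i₁ : A₀.carrier → A₁.carrier) (i₂ : A₀.carrier → A₂.carrier),
        IsECAHom A₀ A₁ i₁ ∧ Function.Injective i₁ ∧
        IsECAHom A₀ A₂ i₂ ∧ Function.Injective i₂ ∧
        ¬ ∃ (B : ECA α κ) (m₁ : A₁.carrier → B.carrier) (m₂ : A₂.carrier → B.carrier),
            IsECA B ∧ IsECAHom A₁ B m₁ ∧ Function.Injective m₁ ∧
            IsECAHom A₂ B m₂ ∧ Function.Injective m₂ ∧ m₁ ∘ i₁ = m₂ ∘ i₂ := by
  classical
  obtain ⟨o, l, hol⟩ := exists_pair_ne α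
  have : Fact (Nat.Prime 2) := ⟨Nat.prime_two⟩
  have : Fact (Nat.Prime 3) := ⟨Nat.prime_three⟩
  obtain ⟨U, Z, χ, P, hA, hB, hC, hD, hE, neU⟩ := ECAaux.exists_model o l hol 2
  obtain ⟨U', Z', χ', P', hA', hB', hC', hD', hE', neU'⟩ := ECAaux.exists_model o l hol 3
  have gX := ECAaux.good_model o l hol χ P hA hB hC hD hE
  have gX' := ECAaux.good_model o l hol χ' P' hA' hB' hC' hD' hE'
  generalize hX : {t | Injective t ∧ χ (P t) (t o) = χ (P t) (t l)} = X at gX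
  generalize hX' : {t | Injective t ∧ χ' (P' t) (t o) = χ' (P' t) (t l)} = X' at gX'
  obtain ⟨h1, h1i⟩ := ECAaux.emb_hom (κ := κ) gX gX
  obtain ⟨h2, h2i⟩ := ECAaux.emb_hom (κ := κ) gX gX'
  refine ⟨ECAaux.tyECA α κ X, setECA α κ U, setECA α κ U', hR _ (ECAaux.rep_of_emb U _ h1 h1i),
    hR _ (ECAaux.setECA_rep U), hR _ (ECAaux.setECA_rep U'), ECAaux.emb X X, ECAaux.emb X X',
    h1, h1i, h2, h2i, ?_⟩
  rintro ⟨B, m₁, m₂, hB, hm₁, im₁, hm₂, im₂, hcomm⟩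
  have so := ECAaux.smallSet_singleton hκ o
  have sl := ECAaux.smallSet_singleton hκ l
  have sd := ECAaux.smallEquiv_pair hκ o l
  -- the common elements
  have tot : ∀ t : α → U', ECAaux.ty X' t ∈ Set.range (ECAaux.ty X) := fun t => by
    obtain ⟨s, hs⟩ := ECAaux.total gX' gX t
    exact ⟨s, hs.symm⟩
  have ce : m₁ ({t | Injective t} : Set (α → U)) = m₂ ({t | Injective t} : Set (α → U')) := by
    let S : Set (Set.range (ECAaux.ty X)) := {p | ∀ i j, p.1.1 i j → i = j}
    have h : ({t | Injective t} : Set (α → U)) = ECAaux.emb (κ := κ) X X S :=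
      Set.ext fun t => ⟨fun h => ⟨⟨t, rfl⟩, fun i j hij => h hij⟩,
        fun h i j hij => h.2 i j hij⟩
    have h' : ({t | Injective t} : Set (α → U')) = ECAaux.emb (κ := κ) X X' S :=
      Set.ext fun t => ⟨fun h => ⟨tot t, fun i j hij => h hij⟩,
        fun h i j hij => h.2 i j hij⟩
    exact (congrArg m₁ h).trans ((congrFun hcomm S).trans (congrArg m₂ h'.symm))
  have cx : m₁ X = m₂ X' := by
    let S : Set (Set.range (ECAaux.ty X)) := {p | p.1.2}
    have h : X = ECAaux.emb (κ := κ) X X S :=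
      Set.ext fun t => ⟨fun h => ⟨⟨t, rfl⟩, h⟩, fun h => h.2⟩
    have h' : X' = ECAaux.emb (κ := κ) X X' S :=
      Set.ext fun t => ⟨fun h => ⟨tot t, h⟩, fun h => h.2⟩
    exact (congrArg m₁ h).trans ((congrFun hcomm S).trans (congrArg m₂ h'.symm))
  let Y : Set (α → U) := {t | χ (P t) (t o) = 0}
  let W : ZMod 3 → Set (α → U') := fun i =>
    {t | (∀ a b, a ≠ l → b ≠ l → t a = t b → a = b) ∧ χ' (P' t) (t o) = i}
  let F : Set (α → U') := {t | ∀ a b, a ≠ o → a ≠ l → b ≠ o → b ≠ l → t a = t b → a = b}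
  have hPP : ∀ (s t : α → U), (∀ j ∉ ({o} : Set α), s j = t j) → P s = P t :=
    fun s t h => hC s t fun j ho _ => h j ho
  have hPP' : ∀ (s t : α → U'), (∀ j ∉ ({o} : Set α), s j = t j) → P' s = P' t :=
    fun s t h => hC' s t fun j ho _ => h j ho
  have hQQ : ∀ (s t : α → U), (∀ j ∉ ({l} : Set α), s j = t j) → P s = P t :=
    fun s t h => hC s t fun j _ hl => h j hl
  have hQQ' : ∀ (s t : α → U'), (∀ j ∉ ({l} : Set α), s j = t j) → P' s = P' t :=
    fun s t h => hC' s t fun j _ hl => h j hl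
  have hY : (setECA α κ U).c {l} Y = Y := by
    refine Set.ext fun t => ⟨?_, fun h => ⟨t, h, fun _ _ => rfl⟩⟩
    rintro ⟨s, hs, hst⟩
    change χ (P t) (t o) = 0
    rw [← hQQ s t hst, ← hst o hol]
    exact hs
  have hW : ∀ i, (setECA α κ U').c {l} (W i) = W i := by
    intro i
    refine Set.ext fun t => ⟨?_, fun h => ⟨t, h, fun _ _ => rfl⟩⟩
    rintro ⟨s, hs, hst⟩
    refine ⟨fun a b ha hb hab => hs.1 a b ha hb (by rw [hst a ha, hst b hb, hab]), ?_⟩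
    rw [← hQQ' s t hst, ← hst o hol]
    exact hs.2
  have hYX : ∀ c : ZMod 2, ∀ t : α → U, Injective t → χ (P t) (t o) = c →
      (∃ s : α → U, ((∀ i j, pairRel o l i j → s i = s j) ∧ χ (P s) (s o) = c) ∧
        ∀ j ∉ ({o} : Set α), s j = t j) →
      t ∈ X := by
    rintro c t hi ht ⟨s, ⟨hs1, hs2⟩, hst⟩
    have e1 : s o = s l := hs1 o l (Or.inr (Or.inl ⟨rfl, rfl⟩))
    change χ (P s) (s o) = c at hs2
    rw [hPP s t hst, e1, hst l (Ne.symm hol)] at hs2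
    rw [← hX]
    exact ⟨hi, ht.trans hs2.symm⟩
  have hy1 : ({t | Injective t} : Set (α → U)) ∩ Y ∩
      (setECA α κ U).c {o} ((setECA α κ U).d (pairRel o l) ⊓ Y) ⊆ X := by
    rintro t ⟨⟨ht1, ht2⟩, ht3⟩
    exact hYX 0 t ht1 ht2 ht3
  have hy2 : ({t | Injective t} : Set (α → U)) ∩ Yᶜ ∩
      (setECA α κ U).c {o} ((setECA α κ U).d (pairRel o l) ⊓ Yᶜ) ⊆ X := by
    rintro t ⟨⟨ht1, ht2⟩, s, ⟨hs1, hs2⟩, hst⟩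
    exact hYX 1 t ht1 ((ECAaux.zmod2 _).1 ht2) ⟨s, ⟨hs1, (ECAaux.zmod2 _).1 hs2⟩, hst⟩
  have hww : ∀ i j, i ≠ j → W i ∩
      (setECA α κ U').c {o} ((setECA α κ U').d (pairRel o l) ⊓ W j) ⊆
        ({t | Injective t} : Set (α → U')) ∩ X'ᶜ := by
    rintro i j hij t ⟨⟨ht1, ht2⟩, s, ⟨hs1, hs2, hs3⟩, hst⟩
    have e1 : s o = s l := hs1 o l (Or.inr (Or.inl ⟨rfl, rfl⟩))
    have e2 : s o = t l := by rw [e1, hst l (Ne.symm hol)]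
    rw [hPP' s t hst, e2] at hs3
    have hne : t o ≠ t l := by
      intro h; rw [h] at ht2; exact hij (ht2.symm.trans hs3)
    have hl : ∀ b, b ≠ l → t b ≠ t l := by
      intro b hb h
      by_cases hbo : b = o
      · subst hbo; exact hne h
      · have := hs2 o b hol hb (by rw [e2, hst b hbo, h])
        exact hbo this.symm
    refine ⟨?_, ?_⟩
    · intro a b hab
      by_cases ha : a = l <;> by_cases hb : b = l
      · rw [ha, hb]
      · subst ha; exact (hl b hb hab.symm).elim
      · subst hb; exact (hl a ha hab).elim
      · exact ht1 a b ha hb hab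
    · rw [← hX']
      rintro ⟨-, h⟩
      rw [ht2, hs3] at h
      exact hij h
  have hF : ∀ i, (setECA α κ U').c {o} (W i) = F := by
    intro i
    refine Set.ext fun t => ⟨?_, ?_⟩
    · rintro ⟨s, hs, hst⟩ a b ha ha' hb hb' hab
      exact hs.1 a b ha' hb' (by rw [hst a ha, hst b hb, hab])
    · intro ht
      obtain ⟨b, hb, hbi⟩ := hA' (P' t) i t
      have hu : ∀ j ∉ ({o} : Set α), update t o b j = t j := fun j hj => update_of_ne hj _ _
      refine ⟨update t o b, ⟨?_, ?_⟩, hu⟩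
      · intro c d hc hd hcd
        by_cases hco : c = o <;> by_cases hdo : d = o
        · rw [hco, hdo]
        · subst hco
          rw [update_self, update_of_ne hdo] at hcd
          exact (hb ⟨d, hcd.symm⟩).elim
        · subst hdo
          rw [update_self, update_of_ne hco] at hcd
          exact (hb ⟨c, hcd⟩).elim
        · rw [update_of_ne hdo, update_of_ne hco] at hcd
          exact ht c d hco hc hdo hd hcd
      · rw [hPP' _ t hu, update_self]
        exact hbi
  have main := ECAaux.no_amalg_abs hB hκ o l m₁ m₂ hm₁ hm₂ W Y
    ({t | Injective t} : Set (α → U)) X ({t | Injective t} : Set (α → U')) X' F ce cx hW hY hy1 hy2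
    hww hF
  have hF0 : F = (⊥ : Set (α → U')) := im₂ (main.trans hm₂.map_bot.symm)
  obtain ⟨g, hg, -⟩ := hE' (fun _ => Classical.arbitrary U')
  have hgF : g ∈ F := fun a b _ _ _ _ h => hg h
  rw [hF0] at hgF
  exact hgF
end

section
/- Let A be a PEA_{κ,α} and let 0, 1 denote the first two (distinct) elements of α. Writing c_i for c_{({i})} and s⁰₁ for s_{[0|1]}, for all x, y, z ∈ A: c_0(x · c_1 y) · c_0(x · −c_1 y) ≤ c_0 c_1(c_1 z · s⁰₁ c_1 z · −d_{01}) + c_0(x · −c_1 z). -/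
universe u

open Cardinal Function Set

/-- `τ ∈ G_κ` : a transformation with support of cardinality `< κ`. -/
def SmallSupp {α : Type u} (κ : Cardinal.{u}) (τ : α → α) : Prop := #{i | τ i ≠ i} < κ

/-- The similarity type of κ-generalized polyadic equality algebras of dimension α:
a Boolean algebra with cylindrifications `c`, substitutions `s` and diagonals `d`.
(The operations are total; the `PEA` axioms below constrain them on indices in
`SmallSet κ`, `SmallSupp κ`, `SmallEquiv κ` respectively.) -/
structure PEA (α : Type u) (κ : Cardinal.{u}) : Type (u + 1) where
  carrier : Type u
  [ba : BooleanAlgebra carrier]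
  c : Set α → carrier → carrier
  s : (α → α) → carrier → carrier
  d : (α → α → Prop) → carrier

attribute [instance] PEA.ba

/-- The axioms of `PEA_{κ,α}`. -/
structure IsPEA {α : Type u} {κ : Cardinal.{u}} (A : PEA α κ) : Prop where
  c_bot : ∀ Γ, SmallSet κ Γ → A.c Γ ⊥ = ⊥
  le_c : ∀ Γ x, SmallSet κ Γ → x ≤ A.c Γ x
  c_inf_c : ∀ Γ x y, SmallSet κ Γ → A.c Γ (x ⊓ A.c Γ y) = A.c Γ x ⊓ A.c Γ y
  c_c : ∀ Γ Δ x, SmallSet κ Γ → SmallSet κ Δ → A.c Γ (A.c Δ x) = A.c (Γ ∪ Δ) x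
  s_sup : ∀ τ x y, SmallSupp κ τ → A.s τ (x ⊔ y) = A.s τ x ⊔ A.s τ y
  s_inf : ∀ τ x y, SmallSupp κ τ → A.s τ (x ⊓ y) = A.s τ x ⊓ A.s τ y
  s_compl : ∀ τ x, SmallSupp κ τ → A.s τ xᶜ = (A.s τ x)ᶜ
  s_bot : ∀ τ, SmallSupp κ τ → A.s τ ⊥ = ⊥
  s_top : ∀ τ, SmallSupp κ τ → A.s τ ⊤ = ⊤
  s_id : ∀ x, A.s id x = x
  s_comp : ∀ σ τ x, SmallSupp κ σ → SmallSupp κ τ → A.s (σ ∘ τ) x = A.s σ (A.s τ x)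
  s_c_congr : ∀ σ τ Γ x, SmallSupp κ σ → SmallSupp κ τ → SmallSet κ Γ →
    (∀ i ∉ Γ, σ i = τ i) → A.s σ (A.c Γ x) = A.s τ (A.c Γ x)
  c_s : ∀ τ Γ Δ x, SmallSupp κ τ → SmallSet κ Γ → τ ⁻¹' Γ = Δ → Set.InjOn τ Δ →
    A.c Γ (A.s τ x) = A.s τ (A.c Δ x)
  d_id : A.d (· = ·) = ⊤
  c_d : ∀ Γ E, SmallSet κ Γ → SmallEquiv κ E →
    A.c Γ (A.d E) = A.d (fun a b => (E a b ∧ a ∉ Γ ∧ b ∉ Γ) ∨ a = b)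
  s_d : ∀ τ E, SmallSupp κ τ → SmallEquiv κ E →
    A.s τ (A.d E) = A.d (fun a b => (∃ p q, E p q ∧ τ p = a ∧ τ q = b) ∨ a = b)
  inf_diag_le : ∀ i j x, x ⊓ A.d (pairRel i j) ≤ A.s (repl i j) x

/-- Homomorphisms of `PEA`s: maps preserving the Boolean structure and the
(small-indexed) cylindrifications, substitutions and diagonals. -/
structure IsPEAHom {α : Type u} {κ : Cardinal.{u}} (A B : PEA α κ)
    (f : A.carrier → B.carrier) : Prop where
  map_sup : ∀ x y, f (x ⊔ y) = f x ⊔ f y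
  map_inf : ∀ x y, f (x ⊓ y) = f x ⊓ f y
  map_compl : ∀ x, f xᶜ = (f x)ᶜ
  map_bot : f ⊥ = ⊥
  map_top : f ⊤ = ⊤
  map_c : ∀ Γ x, SmallSet κ Γ → f (A.c Γ x) = B.c Γ (f x)
  map_s : ∀ τ x, SmallSupp κ τ → f (A.s τ x) = B.s τ (f x)
  map_d : ∀ E, SmallEquiv κ E → f (A.d E) = B.d E

/-- The full set algebra on `ᵅU`. -/
def setPEA (α : Type u) (κ : Cardinal.{u}) (U : Type u) : PEA α κ where
  carrier := Set (α → U)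
  c := fun Γ X => {s | ∃ t ∈ X, ∀ j ∉ Γ, t j = s j}
  s := fun τ X => {s | s ∘ τ ∈ X}
  d := fun E => {s | ∀ i j, E i j → s i = s j}

/-- The product of a family of `PEA`s. -/
def prodPEA {α : Type u} {κ : Cardinal.{u}} {ι : Type u} (A : ι → PEA α κ) : PEA α κ where
  carrier := ∀ i, (A i).carrier
  c := fun Γ x i => (A i).c Γ (x i)
  s := fun τ x i => (A i).s τ (x i)
  d := fun E i => (A i).d E

/-- Representable algebras: members of `SP` of the class of full set algebras, i.e.
algebras embeddable into a product of full set algebras. -/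
def IsRepresentable {α : Type u} {κ : Cardinal.{u}} (A : PEA α κ) : Prop :=
  ∃ (ι : Type u) (U : ι → Type u)
    (f : A.carrier → (prodPEA (fun i => setPEA α κ (U i))).carrier),
      IsPEAHom A (prodPEA (fun i => setPEA α κ (U i))) f ∧ Function.Injective f

namespace PigozziAux

variable {α : Type u} {κ : Cardinal.{u}} {A : PEA α κ}

theorem mono (hA : IsPEA A) {Γ : Set α} (hΓ : SmallSet κ Γ) {x y : A.carrier} (h : x ≤ y) :
    A.c Γ x ≤ A.c Γ y := by
  have h1 : x ⊓ A.c Γ y = x := inf_eq_left.2 (h.trans (hA.le_c Γ y hΓ))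
  have h2 := hA.c_inf_c Γ x y hΓ
  rw [h1] at h2
  exact inf_eq_left.1 h2.symm

theorem idem (hA : IsPEA A) {Γ : Set α} (hΓ : SmallSet κ Γ) (x : A.carrier) :
    A.c Γ (A.c Γ x) = A.c Γ x := by
  rw [hA.c_c Γ Γ x hΓ hΓ, Set.union_self]

theorem closed_inf (hA : IsPEA A) {Γ : Set α} (hΓ : SmallSet κ Γ) {p q : A.carrier}
    (hp : A.c Γ p = p) (hq : A.c Γ q = q) : A.c Γ (p ⊓ q) = p ⊓ q := by
  have h := hA.c_inf_c Γ p q hΓ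
  rwa [hq, hp] at h

theorem closed_compl (hA : IsPEA A) {Γ : Set α} (hΓ : SmallSet κ Γ) {p : A.carrier}
    (hp : A.c Γ p = p) : A.c Γ pᶜ = pᶜ := by
  apply le_antisymm _ (hA.le_c Γ _ hΓ)
  have h := hA.c_inf_c Γ pᶜ p hΓ
  rw [hp, compl_inf_eq_bot, hA.c_bot Γ hΓ] at h
  exact le_compl_iff_disjoint_right.2 (disjoint_iff.2 h.symm)

theorem sup_le (hA : IsPEA A) {Γ : Set α} (hΓ : SmallSet κ Γ) (x y : A.carrier) :
    A.c Γ (x ⊔ y) ≤ A.c Γ x ⊔ A.c Γ y := by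
  have hw : A.c Γ ((A.c Γ x)ᶜ ⊓ (A.c Γ y)ᶜ) = (A.c Γ x)ᶜ ⊓ (A.c Γ y)ᶜ :=
    closed_inf hA hΓ (closed_compl hA hΓ (idem hA hΓ x)) (closed_compl hA hΓ (idem hA hΓ y))
  rw [← compl_sup] at hw
  have h2 := closed_compl hA hΓ hw
  rw [compl_compl] at h2
  rw [← h2]
  exact mono hA hΓ (sup_le_sup (hA.le_c Γ x hΓ) (hA.le_c Γ y hΓ))

end PigozziAux

open PigozziAux in
/-- Pigozzi's inequality `r ≤ s` in any `PEA_{κ,α}`, where `0, 1` are the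
first two (distinct) elements of `α`: writing `c_i` for `c_{({i})}` and `s⁰₁` for
`s_{[0|1]}`, we have
`c_0(x·c_1 y)·c_0(x·−c_1 y) ≤ c_0 c_1(c_1 z·s⁰₁c_1 z·−d_{01}) + c_0(x·−c_1 z)`. -/
theorem pigozzi_inequality {α : Type u} {κ : Cardinal.{u}} [Infinite α]
    (hκ : ℵ₀ ≤ κ) (hκα : κ ≤ #α)
    (A : PEA α κ) (hA : IsPEA A) (e₀ e₁ : α) (h01 : e₀ ≠ e₁) (x y z : A.carrier) :
    A.c {e₀} (x ⊓ A.c {e₁} y) ⊓ A.c {e₀} (x ⊓ (A.c {e₁} y)ᶜ) ≤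
      A.c {e₀} (A.c {e₁}
        (A.c {e₁} z ⊓ A.s (repl e₀ e₁) (A.c {e₁} z) ⊓ (A.d (pairRel e₀ e₁))ᶜ)) ⊔
      A.c {e₀} (x ⊓ (A.c {e₁} z)ᶜ) := by
  classical
  have small : ∀ Γ : Set α, Γ.Finite → SmallSet κ Γ := fun Γ h =>
    lt_of_lt_of_le (Cardinal.lt_aleph0_iff_set_finite.2 h) hκ
  have k0 : SmallSet κ ({e₀} : Set α) := small _ (Set.finite_singleton _)
  have k1 : SmallSet κ ({e₁} : Set α) := small _ (Set.finite_singleton _)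
  have k01 : SmallSet κ ({e₀} ∪ {e₁} : Set α) :=
    small _ ((Set.finite_singleton _).union (Set.finite_singleton _))
  have kr : SmallSupp κ (repl e₀ e₁) := by
    apply small
    apply (Set.finite_singleton e₀).subset
    intro i hi
    by_contra h
    exact hi (by simp only [repl]; exact if_neg h)
  have ks : SmallSupp κ (Equiv.swap e₀ e₁ : α → α) := by
    apply small
    apply ((Set.finite_singleton e₀).union (Set.finite_singleton e₁)).subset
    intro i hi
    by_contra h
    simp only [Set.mem_union, Set.mem_singleton_iff, not_or] at h
    exact hi (Equiv.swap_apply_of_ne_of_ne h.1 h.2)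
  have kid : SmallSupp κ (id : α → α) := by
    apply small
    simp
  have cyl_comm : ∀ p, A.c {e₀} (A.c {e₁} p) = A.c {e₁} (A.c {e₀} p) := fun p => by
    rw [hA.c_c _ _ _ k0 k1, hA.c_c _ _ _ k1 k0, Set.union_comm]
  have hrs : ∀ q, A.c {e₁} q = q → A.s (repl e₀ e₁) q = A.s (Equiv.swap e₀ e₁) q := by
    intro q hq
    have h := hA.s_c_congr (repl e₀ e₁) (Equiv.swap e₀ e₁) {e₁} q kr ks k1 (by
      intro i hi
      simp only [Set.mem_singleton_iff] at hi
      by_cases h : i = e₀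
      · subst h
        simp [repl]
      · rw [Equiv.swap_apply_of_ne_of_ne h hi]
        simp [repl, h])
    rwa [hq] at h
  have pre1 : (Equiv.swap e₀ e₁ : α → α) ⁻¹' {e₁} = {e₀} := by
    ext i
    simp only [Set.mem_preimage, Set.mem_singleton_iff]
    rw [Equiv.swap_apply_eq_iff, Equiv.swap_apply_right]
  have pre0 : (Equiv.swap e₀ e₁ : α → α) ⁻¹' {e₀} = {e₁} := by
    ext i
    simp only [Set.mem_preimage, Set.mem_singleton_iff]
    rw [Equiv.swap_apply_eq_iff, Equiv.swap_apply_left]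
  have s0 : ∀ q, A.c {e₁} q = q →
      A.c {e₀} (A.s (repl e₀ e₁) q) = A.s (repl e₀ e₁) q := by
    intro q hq
    rw [hrs q hq, hA.c_s _ _ _ q ks k0 pre0 (Equiv.injective _).injOn, hq]
  have s1 : ∀ q, A.c {e₁} q = q →
      A.c {e₁} (A.s (repl e₀ e₁) q) = A.c {e₀} q := by
    intro q hq
    rw [hrs q hq, hA.c_s _ _ _ q ks k1 pre1 (Equiv.injective _).injOn]
    have h := hA.s_c_congr (Equiv.swap e₀ e₁) id ({e₀} ∪ {e₁}) q ks kid k01 (by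
      intro i hi
      simp only [Set.mem_union, Set.mem_singleton_iff, not_or] at hi
      exact Equiv.swap_apply_of_ne_of_ne hi.1 hi.2)
    rwa [hA.s_id, ← hA.c_c _ _ _ k0 k1, hq] at h
  have hY := idem hA k1 y
  have hZ := idem hA k1 z
  generalize A.c {e₁} y = Y at *
  generalize A.c {e₁} z = Z at *
  have hP := closed_inf hA k1 hY hZ
  have hQ := closed_inf hA k1 (closed_compl hA k1 hY) hZ
  have hPQ : (Y ⊓ Z) ⊓ (Yᶜ ⊓ Z) = ⊥ := by
    rw [← le_bot_iff, ← inf_compl_eq_bot (a := Y)]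
    exact le_inf (inf_le_left.trans inf_le_left) (inf_le_right.trans inf_le_left)
  have smono : ∀ p q, p ≤ q → A.s (repl e₀ e₁) p ≤ A.s (repl e₀ e₁) q := by
    intro p q h
    have h2 := hA.s_inf _ p q kr
    rw [inf_eq_left.2 h] at h2
    exact inf_eq_left.1 h2.symm
  have key : A.c {e₀} (Y ⊓ Z) ⊓ A.c {e₀} (Yᶜ ⊓ Z) ≤
      A.c {e₀} (A.c {e₁} (Z ⊓ A.s (repl e₀ e₁) Z ⊓ (A.d (pairRel e₀ e₁))ᶜ)) := by
    generalize hPd : Y ⊓ Z = P at *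
    generalize hQd : Yᶜ ⊓ Z = Q at *
    have e1 : A.c {e₀} P ⊓ A.c {e₀} Q = A.c {e₀} (A.c {e₁} (P ⊓ A.s (repl e₀ e₁) Q)) := by
      rw [cyl_comm]
      conv_rhs => rw [← s0 Q hQ, hA.c_inf_c _ _ _ k0, s0 Q hQ]
      have h3 : A.c {e₁} (A.c {e₀} P) = A.c {e₀} P := by rw [← cyl_comm, hP]
      rw [← h3, inf_comm (A.c {e₁} _) (A.s _ _), hA.c_inf_c _ _ _ k1, s1 Q hQ, inf_comm]
    rw [e1]
    apply mono hA k0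
    apply mono hA k1
    refine le_inf (le_inf ?_ ?_) ?_
    · exact inf_le_left.trans (hPd ▸ inf_le_right)
    · exact inf_le_right.trans (smono _ _ (hQd ▸ inf_le_right))
    · rw [le_compl_iff_disjoint_right, disjoint_iff_inf_le]
      have h4 := hA.inf_diag_le e₀ e₁ P
      calc _ ≤ A.s (repl e₀ e₁) P ⊓ A.s (repl e₀ e₁) Q :=
            le_inf ((le_inf (inf_le_left.trans inf_le_left) inf_le_right).trans h4)
              (inf_le_left.trans inf_le_right)
        _ = ⊥ := by rw [← hA.s_inf _ _ _ kr, hPQ, hA.s_bot _ kr]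
        _ ≤ ⊥ := le_rfl
  have split : ∀ W, A.c {e₀} (x ⊓ W) ≤ A.c {e₀} (W ⊓ Z) ⊔ A.c {e₀} (x ⊓ Zᶜ) := by
    intro W
    refine le_trans (mono hA k0 ?_) (PigozziAux.sup_le hA k0 _ _)
    calc x ⊓ W = (x ⊓ W) ⊓ Z ⊔ (x ⊓ W) ⊓ Zᶜ := by rw [← inf_sup_left, sup_compl_eq_top, inf_top_eq]
      _ ≤ _ := sup_le_sup (inf_le_inf_right _ inf_le_right) (inf_le_inf_right _ inf_le_left)
  refine (inf_le_inf (split Y) (split Yᶜ)).trans ?_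
  rw [← sup_inf_right]
  exact sup_le_sup_right key _
end

section
/- Let α be an infinite linearly ordered type, Γ a finite subset of α containing the two distinguished distinct elements 0 and 1, and let Z = {φ ∈ X_Id | φ(0) < φ(1)} ∩ K_Γ and W = {φ ∈ X_Id | φ(0) > φ(1)} ∩ K_Γ. Then c_0(X_Id ∖ c_1 Z) ∩ c_0(X_Id ∖ c_1 W) ∩ K_Γ = ∅. -/
open Set Function

variable {α : Type*}

/-- Cylindrification on `Γ'` of a set of `α`-sequences over `α`. -/
def cyl (Γ' : Set α) (X : Set (α → α)) : Set (α → α) :=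
  {s | ∃ t ∈ X, ∀ j ∉ Γ', t j = s j}

/-- `X_Id`: the set of injective maps `α → α`. -/
def XId (α : Type*) : Set (α → α) := {φ | Function.Injective φ}

/-- `K_Γ = c_{(Γ)}{id} = {φ | φ j = j for all j ∉ Γ}`. -/
def KK (Γ : Finset α) : Set (α → α) := cyl (↑Γ) {id}

/-- `Δφ = Γ ∖ φ[Γ∖{0,1}]`. -/
def Dl (Γ : Finset α) (e₀ e₁ : α) (φ : α → α) : Set α :=
  ↑Γ \ (φ '' (↑Γ \ {e₀, e₁}))

/-- With `Z = {φ ∈ X_Id | φ(0) < φ(1)} ∩ K_Γ` and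
`W = {φ ∈ X_Id | φ(0) > φ(1)} ∩ K_Γ`,
`c_0(X_Id ∖ c_1 Z) ∩ c_0(X_Id ∖ c_1 W) ∩ K_Γ = ∅`. -/
theorem cyl_diff_inter_empty [LinearOrder α] [Infinite α] (Γ : Finset α) (e₀ e₁ : α)
    (h01 : e₀ ≠ e₁) (h₀ : e₀ ∈ Γ) (h₁ : e₁ ∈ Γ) :
    cyl {e₀} (XId α \ cyl {e₁} ({φ ∈ XId α | φ e₀ < φ e₁} ∩ KK Γ)) ∩
      cyl {e₀} (XId α \ cyl {e₁} ({φ ∈ XId α | φ e₁ < φ e₀} ∩ KK Γ)) ∩ KK Γ = ∅ := by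
  ext s
  simp only [Set.mem_inter_iff, Set.mem_empty_iff_false, iff_false]
  rintro ⟨⟨⟨a, ⟨ha, haZ⟩, has⟩, ⟨b, ⟨hb, hbW⟩, hbs⟩⟩, ⟨i, hi, his⟩⟩
  have hi' : i = id := hi
  subst hi'
  have ha' : Function.Injective a := ha
  have hb' : Function.Injective b := hb
  have haK : ∀ j, j ∉ Γ → a j = j := by
    intro j hj
    have h1 : j ≠ e₀ := by rintro rfl; exact hj h₀
    rw [has j (by simpa using h1), ← his j (by simpa using hj)]; rfl
  have hbK : ∀ j, j ∉ Γ → b j = j := by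
    intro j hj
    have h1 : j ≠ e₀ := by rintro rfl; exact hj h₀
    rw [hbs j (by simpa using h1), ← his j (by simpa using hj)]; rfl
  have haΓ : ∀ x ∈ Γ, a x ∈ Γ := by
    intro x hx
    by_contra h
    exact h ((ha' (haK _ h)).symm ▸ hx)
  have hbΓ : ∀ x ∈ Γ, b x ∈ Γ := by
    intro x hx
    by_contra h
    exact h ((hb' (hbK _ h)).symm ▸ hx)
  have hsurj : Set.SurjOn a Γ Γ :=
    Finset.surjOn_of_injOn_of_card_le a (fun x hx => haΓ x hx) ha'.injOn le_rfl
  have hab : ∀ x, x ≠ e₀ → a x = b x := fun x hx => by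
    rw [has x (by simpa using hx), hbs x (by simpa using hx)]
  have h0 : a e₀ = b e₀ := by
    obtain ⟨x, hx, hxe⟩ := hsurj (hbΓ e₀ h₀)
    by_cases h : x = e₀
    · rw [← hxe, h]
    · rw [hab x h] at hxe
      exact absurd (hb' hxe) h
  have hEq : a = b := by
    funext x
    by_cases h : x = e₀
    · rw [h, h0]
    · exact hab x h
  subst hEq
  have hKK : a ∈ KK Γ := ⟨id, rfl, fun j hj => (haK j (by simpa using hj)).symm⟩
  rcases lt_or_gt_of_ne (fun h => h01 (ha' h) : a e₀ ≠ a e₁) with h | h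
  · exact haZ ⟨a, ⟨⟨ha, h⟩, hKK⟩, fun _ _ => rfl⟩
  · exact hbW ⟨a, ⟨⟨ha, h⟩, hKK⟩, fun _ _ => rfl⟩
end
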